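/- arXiv:1901.04035 — 2 statements merged into one kernel-verified Lean document; each statement's English description precedes it below -/
import Mathlib

section
/- Let A be a primitive m×m matrix with entries in {0,1}, let (Σ_A, σ) be the associated subshift of finite type, and let φ : Σ_A → ℝ be Hölder continuous. Then there exists a unique σ-invariant Borel probability measure μ on Σ_A for which there are constants c_1, c_2 > 0 such that for every i ∈ Σ_A and every ℓ ≥ 1, c_1 ≤ μ([i]_ℓ) / exp(−ℓ·P(φ) + S_ℓ φ(i)) ≤ c_2; moreover μ is ergodic. -/
open MeasureTheory Filter Set
open scoped ENNReal

/-- The subshift of finite type determined by a 0-1 matrix `A`. -/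
def SigA {m : ℕ} (A : Matrix (Fin m) (Fin m) ℕ) : Set (ℕ → Fin m) :=
  {ω | ∀ k : ℕ, A (ω k) (ω (k + 1)) = 1}

/-- The Gibbs property of a measure `μ` for the potential `φ` with pressure `P`:
`c₁ ≤ μ([i]_ℓ) / exp(-ℓ P + S_ℓ φ(i)) ≤ c₂` for all `i ∈ Σ_A` and `ℓ ≥ 1`. -/
def GibbsProp {m : ℕ} (A : Matrix (Fin m) (Fin m) ℕ) (φ : (ℕ → Fin m) → ℝ) (P : ℝ)
    (μ : Measure (ℕ → Fin m)) : Prop :=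
  ∃ c₁ c₂ : ℝ, 0 < c₁ ∧ 0 < c₂ ∧ ∀ ω ∈ SigA A, ∀ ℓ : ℕ, 1 ≤ ℓ →
    c₁ ≤ (μ {τ ∈ SigA A | ∀ k < ℓ, τ k = ω k}).toReal /
        Real.exp (-(ℓ : ℝ) * P + ∑ k ∈ Finset.range ℓ, φ (fun j => ω (j + k))) ∧
      (μ {τ ∈ SigA A | ∀ k < ℓ, τ k = ω k}).toReal /
        Real.exp (-(ℓ : ℝ) * P + ∑ k ∈ Finset.range ℓ, φ (fun j => ω (j + k))) ≤ c₂

namespace SubshiftGibbs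

variable {m : ℕ}

/-- The iterated left shift `σ^n`. -/
def shift (n : ℕ) (x : ℕ → Fin m) : ℕ → Fin m := fun j => x (j + n)

/-- The Birkhoff sum `S_n φ`. -/
def birkhoff (φ : (ℕ → Fin m) → ℝ) (n : ℕ) (x : ℕ → Fin m) : ℝ :=
  ∑ k ∈ Finset.range n, φ (shift k x)

/-- The initial word of length `n`. -/
def res (n : ℕ) (x : ℕ → Fin m) : Fin n → Fin m := fun i => x i

theorem res_eq_res {n : ℕ} {x y : ℕ → Fin m} : res n x = res n y ↔ ∀ i < n, x i = y i :=
  ⟨fun h i hi => congrFun h ⟨i, hi⟩, fun h => funext fun i => h i i.2⟩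

theorem birkhoff_add (φ : (ℕ → Fin m) → ℝ) (n k : ℕ) (x : ℕ → Fin m) :
    birkhoff φ (n + k) x = birkhoff φ n x + birkhoff φ k (shift n x) := by
  simp only [birkhoff, Finset.sum_range_add, add_right_inj]
  refine Finset.sum_congr rfl fun i _ => congrArg φ (funext fun j => ?_)
  simp only [shift]
  congr 1
  omega

/-- A closed shift-invariant set with the specification property (with gap `N`), together with a
bounded potential having bounded distortion along Birkhoff sums. -/
structure Specification (S : Set (ℕ → Fin m)) (φ : (ℕ → Fin m) → ℝ) (N : ℕ) (D K : ℝ) :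
    Prop where
  isClosed : IsClosed S
  nonempty : S.Nonempty
  shift_mem : ∀ x ∈ S, ∀ n, shift n x ∈ S
  glue : ∀ x ∈ S, ∀ y ∈ S, ∀ n, ∃ z ∈ S, (∀ j < n, z j = x j) ∧ shift (n + N) z = y
  close : ∀ x ∈ S, ∀ n, 0 < n → ∃ z ∈ S, (∀ j < n, z j = x j) ∧ shift (n + N) z = z
  distortion : ∀ n, ∀ x ∈ S, ∀ y ∈ S, (∀ i < n, x i = y i) → birkhoff φ n x ≤ birkhoff φ n y + D
  bounded : ∀ x ∈ S, |φ x| ≤ K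

/-- The admissible words of length `n`. -/
noncomputable def words (S : Set (ℕ → Fin m)) (n : ℕ) : Finset (Fin n → Fin m) :=
  (Set.toFinite (res n '' S)).toFinset

/-- The supremum of the Birkhoff sum over a cylinder. -/
noncomputable def supBirkhoff (S : Set (ℕ → Fin m)) (φ : (ℕ → Fin m) → ℝ) (n : ℕ)
    (w : Fin n → Fin m) : ℝ :=
  sSup (birkhoff φ n '' {x ∈ S | res n x = w})

/-- The partition function. -/
noncomputable def partition (S : Set (ℕ → Fin m)) (φ : (ℕ → Fin m) → ℝ) (n : ℕ) : ℝ :=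
  ∑ w ∈ words S n, Real.exp (supBirkhoff S φ n w)

theorem mem_words {S : Set (ℕ → Fin m)} {n : ℕ} {w : Fin n → Fin m} :
    w ∈ words S n ↔ ∃ x ∈ S, res n x = w := by
  simp [words]

theorem sum_exp_le_of_rel {ι κ : Type*} {s : Finset ι} {t : Finset κ} {f : ι → ℝ} {g : κ → ℝ}
    {c : ℝ} (r : ι → κ → Prop) (h : ∀ i ∈ s, ∃ j ∈ t, r i j ∧ f i ≤ c + g j)
    (hinj : ∀ i ∈ s, ∀ i' ∈ s, ∀ j, r i j → r i' j → i = i') :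
    ∑ i ∈ s, Real.exp (f i) ≤ Real.exp c * ∑ j ∈ t, Real.exp (g j) := by
  classical
  rcases s.eq_empty_or_nonempty with rfl | ⟨i₀, hi₀⟩
  · simpa using mul_nonneg (Real.exp_pos c).le (Finset.sum_nonneg fun j _ => (Real.exp_pos (g j)).le)
  have : Nonempty κ := ⟨(h i₀ hi₀).choose⟩
  choose! q hq using h
  have hq_inj : Set.InjOn q s := fun i hi i' hi' e =>
    hinj i hi i' hi' (q i) (hq i hi).2.1 (e ▸ (hq i' hi').2.1)
  calc ∑ i ∈ s, Real.exp (f i) ≤ ∑ i ∈ s, Real.exp c * Real.exp (g (q i)) := by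
        refine Finset.sum_le_sum fun i hi => ?_
        rw [← Real.exp_add]
        exact Real.exp_le_exp.2 (hq i hi).2.2
    _ = Real.exp c * ∑ j ∈ s.image q, Real.exp (g j) := by
        rw [← Finset.mul_sum, Finset.sum_image hq_inj]
    _ ≤ Real.exp c * ∑ j ∈ t, Real.exp (g j) := by
        refine mul_le_mul_of_nonneg_left (Finset.sum_le_sum_of_subset_of_nonneg ?_ ?_)
          (Real.exp_pos c).le
        · exact Finset.image_subset_iff.2 fun i hi => (hq i hi).1
        · exact fun _ _ _ => (Real.exp_pos _).le

/-- Points of `S` of period `n`. -/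
def periodicSet (S : Set (ℕ → Fin m)) (n : ℕ) : Set (ℕ → Fin m) :=
  {z ∈ S | 0 < n ∧ shift n z = z}

theorem eq_of_shift_eq {n : ℕ} (hn : 0 < n) {z z' : ℕ → Fin m} (hz : shift n z = z)
    (hz' : shift n z' = z') (h : ∀ i < n, z i = z' i) : z = z' := by
  funext j
  induction j using Nat.strong_induction_on with
  | _ j ih =>
    rcases lt_or_ge j n with hj | hj
    · exact h j hj
    · obtain ⟨i, rfl⟩ := Nat.exists_eq_add_of_le' hj
      have h1 : z (i + n) = z i := congrFun hz i
      have h2 : z' (i + n) = z' i := congrFun hz' i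
      rw [h1, h2, ih i (by omega)]

theorem periodicSet_finite (S : Set (ℕ → Fin m)) (n : ℕ) : (periodicSet S n).Finite :=
  Set.Finite.of_injOn (f := res n) (t := Set.univ) (fun _ _ => Set.mem_univ _)
    (fun _ hz _ hz' h => eq_of_shift_eq hz.2.1 hz.2.2 hz'.2.2 (res_eq_res.1 h)) Set.finite_univ

/-- The points of period `n` as a finset. -/
noncomputable def periodic (S : Set (ℕ → Fin m)) (n : ℕ) : Finset (ℕ → Fin m) :=
  (periodicSet_finite S n).toFinset

theorem mem_periodic {S : Set (ℕ → Fin m)} {n : ℕ} {z : ℕ → Fin m} :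
    z ∈ periodic S n ↔ z ∈ S ∧ 0 < n ∧ shift n z = z :=
  Set.Finite.mem_toFinset _

open Classical in
/-- The partition function of the points of period `n` that share their first `ℓ` letters with
`x`. -/
noncomputable def periodicPartition (S : Set (ℕ → Fin m)) (φ : (ℕ → Fin m) → ℝ)
    (x : ℕ → Fin m) (ℓ n : ℕ) : ℝ :=
  ∑ z ∈ periodic S n with ∀ i < ℓ, z i = x i, Real.exp (birkhoff φ n z)

namespace Specification

variable {S : Set (ℕ → Fin m)} {φ : (ℕ → Fin m) → ℝ} {N : ℕ} {D K : ℝ}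

theorem abs_birkhoff_le (hS : Specification S φ N D K) {x : ℕ → Fin m} (hx : x ∈ S) (n : ℕ) :
    |birkhoff φ n x| ≤ n * K := by
  calc |birkhoff φ n x| ≤ ∑ k ∈ Finset.range n, |φ (shift k x)| := Finset.abs_sum_le_sum_abs _ _
    _ ≤ ∑ _k ∈ Finset.range n, K :=
        Finset.sum_le_sum fun k _ => hS.bounded _ (hS.shift_mem x hx k)
    _ = n * K := by simp

theorem birkhoff_le_supBirkhoff (hS : Specification S φ N D K) {x : ℕ → Fin m} (hx : x ∈ S)
    (n : ℕ) : birkhoff φ n x ≤ supBirkhoff S φ n (res n x) := by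
  refine le_csSup ⟨birkhoff φ n x + D, ?_⟩ ⟨x, ⟨hx, rfl⟩, rfl⟩
  rintro _ ⟨y, ⟨hy, hxy⟩, rfl⟩
  exact hS.distortion n y hy x hx (res_eq_res.1 hxy)

theorem supBirkhoff_le (hS : Specification S φ N D K) {x : ℕ → Fin m} (hx : x ∈ S)
    (n : ℕ) : supBirkhoff S φ n (res n x) ≤ birkhoff φ n x + D := by
  refine csSup_le ⟨_, x, ⟨hx, rfl⟩, rfl⟩ ?_
  rintro _ ⟨y, ⟨hy, hxy⟩, rfl⟩
  exact hS.distortion n y hy x hx (res_eq_res.1 hxy)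

theorem partition_pos (hS : Specification S φ N D K) (n : ℕ) : 0 < partition S φ n := by
  obtain ⟨x, hx⟩ := hS.nonempty
  exact Finset.sum_pos (fun _ _ => Real.exp_pos _) ⟨res n x, mem_words.2 ⟨x, hx, rfl⟩⟩

theorem partition_mul (n k : ℕ) : partition S φ n * partition S φ k =
    ∑ p ∈ words S n ×ˢ words S k,
      Real.exp (supBirkhoff S φ n p.1 + supBirkhoff S φ k p.2) := by
  simp only [partition, Finset.sum_mul_sum, Finset.sum_product, Real.exp_add]

theorem partition_add_le (hS : Specification S φ N D K) (n k : ℕ) :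
    partition S φ (n + k) ≤ Real.exp D * (partition S φ n * partition S φ k) := by
  rw [partition_mul]
  refine sum_exp_le_of_rel
    (fun w p => ∃ x ∈ S, res (n + k) x = w ∧ p = (res n x, res k (shift n x))) ?_ ?_
  · intro w hw
    obtain ⟨x, hx, rfl⟩ := mem_words.1 hw
    refine ⟨(res n x, res k (shift n x)), ?_, ⟨x, hx, rfl, rfl⟩, ?_⟩
    · exact Finset.mem_product.2
        ⟨mem_words.2 ⟨x, hx, rfl⟩, mem_words.2 ⟨_, hS.shift_mem x hx n, rfl⟩⟩
    · have h1 := hS.supBirkhoff_le hx (n + k)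
      have h2 := hS.birkhoff_le_supBirkhoff hx n
      have h3 := hS.birkhoff_le_supBirkhoff (hS.shift_mem x hx n) k
      rw [birkhoff_add] at h1
      linarith
  · rintro _ - _ - _ ⟨x, -, rfl, rfl⟩ ⟨y, -, rfl, h⟩
    obtain ⟨h1, h2⟩ := Prod.ext_iff.1 h
    rw [res_eq_res] at h1 h2 ⊢
    intro i hi
    rcases lt_or_ge i n with hin | hin
    · exact h1 i hin
    · obtain ⟨j, rfl⟩ := Nat.exists_eq_add_of_le' hin
      exact h2 j (by omega)

theorem partition_mul_le_gap (hS : Specification S φ N D K) (n k : ℕ) :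
    partition S φ n * partition S φ k ≤
      Real.exp (2 * D + N * K) * partition S φ (n + N + k) := by
  rw [partition_mul]
  refine sum_exp_le_of_rel
    (fun p w => ∃ z, p = (res n z, res k (shift (n + N) z)) ∧ res (n + N + k) z = w) ?_ ?_
  · rintro ⟨w₁, w₂⟩ hw
    obtain ⟨hw₁, hw₂⟩ := Finset.mem_product.1 hw
    obtain ⟨x, hx, rfl⟩ := mem_words.1 hw₁
    obtain ⟨y, hy, rfl⟩ := mem_words.1 hw₂
    obtain ⟨z, hz, hzx, rfl⟩ := hS.glue x hx y hy n
    have hzx' : res n z = res n x := res_eq_res.2 hzx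
    refine ⟨_, mem_words.2 ⟨z, hz, rfl⟩, ⟨z, by rw [hzx'], rfl⟩, ?_⟩
    have h1 := hS.birkhoff_le_supBirkhoff hz (n + N + k)
    have h2 := hS.supBirkhoff_le hz n
    have h3 := hS.supBirkhoff_le hy k
    have h4 := abs_le.1 (hS.abs_birkhoff_le (hS.shift_mem z hz n) N)
    rw [birkhoff_add, birkhoff_add] at h1
    simp only [← hzx']
    linarith [h4.1]
  · rintro _ - _ - _ ⟨z, rfl, rfl⟩ ⟨z', rfl, h⟩
    rw [res_eq_res] at h
    simp only [Prod.mk.injEq, res_eq_res]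
    refine ⟨fun i hi => ?_, fun i hi => ?_⟩
    · exact (h i (by omega)).symm
    · exact (h (i + (n + N)) (by omega)).symm

theorem partition_mul_le (hS : Specification S φ N D K) (n k : ℕ) :
    partition S φ n * partition S φ k ≤
      Real.exp (3 * D + N * K) * partition S φ N * partition S φ (n + k) := by
  have h1 := hS.partition_mul_le_gap n k
  have h2 := hS.partition_add_le (n + k) N
  rw [show n + k + N = n + N + k by omega] at h2
  calc _ ≤ _ := h1
    _ ≤ Real.exp (2 * D + N * K) * (Real.exp D * (partition S φ (n + k) * partition S φ N)) :=
        mul_le_mul_of_nonneg_left h2 (Real.exp_pos _).le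
    _ = _ := by
        rw [show 3 * D + N * K = 2 * D + N * K + D by ring, Real.exp_add _ D]
        ring

theorem periodicPartition_le (hS : Specification S φ N D K) {x : ℕ → Fin m} (hx : x ∈ S)
    (ℓ k : ℕ) : periodicPartition S φ x ℓ (ℓ + k) ≤
      Real.exp (birkhoff φ ℓ x + D) * partition S φ k := by
  classical
  refine sum_exp_le_of_rel (fun z w => w = res k (shift ℓ z)) ?_ ?_
  · intro z hz
    obtain ⟨hz, hzx⟩ := Finset.mem_filter.1 hz
    have hzS := (mem_periodic.1 hz).1
    have hσ := hS.shift_mem z hzS ℓ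
    refine ⟨_, mem_words.2 ⟨_, hσ, rfl⟩, rfl, ?_⟩
    have h1 := hS.birkhoff_le_supBirkhoff hσ k
    have h2 := hS.distortion ℓ z hzS x hx hzx
    rw [birkhoff_add]
    linarith
  · intro z hz z' hz' w h h'
    obtain ⟨hz, hzx⟩ := Finset.mem_filter.1 hz
    obtain ⟨hz', hzx'⟩ := Finset.mem_filter.1 hz'
    obtain ⟨-, hpos, hper⟩ := mem_periodic.1 hz
    refine eq_of_shift_eq hpos hper (mem_periodic.1 hz').2.2 fun i hi => ?_
    rcases lt_or_ge i ℓ with hil | hil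
    · rw [hzx i hil, hzx' i hil]
    · obtain ⟨j, rfl⟩ := Nat.exists_eq_add_of_le' hil
      exact res_eq_res.1 (h.symm.trans h') j (by omega)

theorem le_periodicPartition (hS : Specification S φ N D K) {x : ℕ → Fin m} (hx : x ∈ S)
    (ℓ : ℕ) {k : ℕ} (hk : 0 < k) :
    partition S φ k ≤ Real.exp (2 * D + 2 * (N * K) - birkhoff φ ℓ x) *
      periodicPartition S φ x ℓ (ℓ + N + k + N) := by
  classical
  refine sum_exp_le_of_rel (fun w z => w = res k (shift (ℓ + N) z)) ?_ ?_
  · intro w hw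
    obtain ⟨y, hy, rfl⟩ := mem_words.1 hw
    obtain ⟨u, hu, hux, rfl⟩ := hS.glue x hx y hy ℓ
    obtain ⟨z, hz, hzu, hper⟩ := hS.close u hu (ℓ + N + k) (by omega)
    have hzx : ∀ i < ℓ, z i = x i := fun i hi => (hzu i (by omega)).trans (hux i hi)
    have hres : res k (shift (ℓ + N) u) = res k (shift (ℓ + N) z) :=
      res_eq_res.2 fun i hi => (hzu (i + (ℓ + N)) (by omega)).symm
    refine ⟨z, Finset.mem_filter.2 ⟨mem_periodic.2 ⟨hz, by omega, hper⟩, hzx⟩, hres, ?_⟩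
    have h1 := hS.supBirkhoff_le (hS.shift_mem z hz (ℓ + N)) k
    have h2 := hS.distortion ℓ x hx z hz fun i hi => (hzx i hi).symm
    have h3 := abs_le.1 (hS.abs_birkhoff_le (hS.shift_mem z hz ℓ) N)
    have h4 := abs_le.1 (hS.abs_birkhoff_le (hS.shift_mem z hz (ℓ + N + k)) N)
    rw [birkhoff_add, birkhoff_add, birkhoff_add, hres]
    linarith [h3.1, h4.1]
  · rintro _ - _ - z rfl rfl
    rfl

end Specification

theorem mul_le_of_subadditive_add_const {u : ℕ → ℝ} {c L : ℝ}
    (hu : ∀ n k, u (n + k) ≤ u n + u k + c)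
    (hL : Tendsto (fun n : ℕ => (n : ℝ)⁻¹ * u n) atTop (nhds L)) (n : ℕ) :
    n * L ≤ u n + c := by
  have hsub : Subadditive fun n => u n + c := fun n k => by linarith [hu n k]
  have hlim : Tendsto (fun n : ℕ => (u n + c) / n) atTop (nhds L) := by
    have := hL.add (tendsto_const_div_atTop_nhds_zero_nat c)
    rw [add_zero] at this
    refine this.congr fun n => ?_
    rw [add_div, div_eq_inv_mul (u n)]
  have hbdd := hlim.bddBelow_range
  rcases Nat.eq_zero_or_pos n with rfl | hn
  · have := hu 0 0
    simp only [add_zero, Nat.cast_zero, zero_mul] at this ⊢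
    linarith
  · have h := hsub.lim_le_div hbdd hn.ne'
    rw [tendsto_nhds_unique (hsub.tendsto_lim hbdd) hlim,
      le_div_iff₀ (Nat.cast_pos.2 hn)] at h
    linarith

namespace Specification

variable {S : Set (ℕ → Fin m)} {φ : (ℕ → Fin m) → ℝ} {N : ℕ} {D K P : ℝ}

theorem exists_log_partition_bound (hS : Specification S φ N D K)
    (hP : Tendsto (fun n : ℕ => (n : ℝ)⁻¹ * Real.log (partition S φ n)) atTop (nhds P)) :
    ∃ c : ℝ, ∀ n : ℕ, n * P - c ≤ Real.log (partition S φ n) ∧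
      Real.log (partition S φ n) ≤ n * P + c := by
  have hpos := hS.partition_pos
  set c' := 3 * D + N * K + Real.log (partition S φ N)
  have hlow := mul_le_of_subadditive_add_const (c := D) (fun n k => by
    have := Real.log_le_log (hpos _) (hS.partition_add_le n k)
    rw [Real.log_mul (Real.exp_pos _).ne' (mul_pos (hpos n) (hpos k)).ne', Real.log_exp,
      Real.log_mul (hpos n).ne' (hpos k).ne'] at this
    linarith) hP
  have hup := mul_le_of_subadditive_add_const (u := fun n => -Real.log (partition S φ n))
    (c := c') (L := -P) (fun n k => by
      have := Real.log_le_log (mul_pos (hpos n) (hpos k)) (hS.partition_mul_le n k)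
      rw [Real.log_mul (mul_pos (Real.exp_pos _) (hpos N)).ne' (hpos _).ne',
        Real.log_mul (Real.exp_pos _).ne' (hpos N).ne', Real.log_exp,
        Real.log_mul (hpos n).ne' (hpos k).ne'] at this
      simp only [c']
      linarith) (by simpa using hP.neg)
  refine ⟨max D c', fun n => ⟨?_, ?_⟩⟩
  · linarith [hlow n, le_max_left D c']
  · linarith [hup n, le_max_right D c']

theorem exists_periodicPartition_bound (hS : Specification S φ N D K)
    (hP : Tendsto (fun n : ℕ => (n : ℝ)⁻¹ * Real.log (partition S φ n)) atTop (nhds P)) :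
    ∃ c : ℝ, ∀ x ∈ S, ∀ ℓ n : ℕ, ℓ + 2 * N + 1 ≤ n →
      Real.exp (birkhoff φ ℓ x + (n - ℓ) * P - c) ≤ periodicPartition S φ x ℓ n ∧
      periodicPartition S φ x ℓ n ≤ Real.exp (birkhoff φ ℓ x + (n - ℓ) * P + c) := by
  obtain ⟨c, hc⟩ := hS.exists_log_partition_bound hP
  refine ⟨c + max D (2 * D + 2 * (N * K) + 2 * N * P), fun x hx ℓ n hn => ⟨?_, ?_⟩⟩
  · obtain ⟨k, rfl⟩ : ∃ k, n = ℓ + N + (k + 1) + N := ⟨n - (ℓ + 2 * N + 1), by omega⟩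
    have h1 := hS.le_periodicPartition hx ℓ k.succ_pos
    have h2 := (Real.le_log_iff_exp_le (hS.partition_pos _)).1 (hc (k + 1)).1
    have h3 := h2.trans h1
    rw [← div_le_iff₀' (Real.exp_pos _), ← Real.exp_sub] at h3
    refine le_trans (Real.exp_le_exp.2 ?_) h3
    push_cast
    linarith [le_max_right D (2 * D + 2 * (N * K) + 2 * N * P)]
  · obtain ⟨k, rfl⟩ : ∃ k, n = ℓ + k := ⟨n - ℓ, by omega⟩
    have h1 := hS.periodicPartition_le hx ℓ k
    have h2 := (Real.log_le_iff_le_exp (hS.partition_pos _)).1 (hc k).2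
    refine h1.trans ((mul_le_mul_of_nonneg_left h2 (Real.exp_pos _).le).trans ?_)
    rw [← Real.exp_add]
    refine Real.exp_le_exp.2 ?_
    push_cast
    linarith [le_max_left D (2 * D + 2 * (N * K) + 2 * N * P)]

end Specification

/-- The cylinder of points sharing their first `n` letters with `x`. -/
def cyl (n : ℕ) (x : ℕ → Fin m) : Set (ℕ → Fin m) := {y | ∀ i < n, y i = x i}

theorem mem_cyl_self (n : ℕ) (x : ℕ → Fin m) : x ∈ cyl n x := fun _ _ => rfl

theorem cyl_eq_of_mem {n : ℕ} {x y : ℕ → Fin m} (h : y ∈ cyl n x) : cyl n y = cyl n x := by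
  ext z
  exact forall₂_congr fun i hi => by rw [h i hi]

theorem cyl_eq_preimage (n : ℕ) (x : ℕ → Fin m) : cyl n x = res n ⁻¹' {res n x} :=
  Set.ext fun _ => res_eq_res.symm

theorem continuous_res (n : ℕ) : Continuous (res n : (ℕ → Fin m) → Fin n → Fin m) :=
  continuous_pi fun _ => continuous_apply _

theorem continuous_shift (n : ℕ) : Continuous (shift n : (ℕ → Fin m) → ℕ → Fin m) :=
  continuous_pi fun _ => continuous_apply _

theorem isClopen_preimage_res (n : ℕ) (T : Set (Fin n → Fin m)) : IsClopen (res n ⁻¹' T) :=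
  (isClopen_discrete T).preimage (continuous_res n)

theorem isClopen_cyl (n : ℕ) (x : ℕ → Fin m) : IsClopen (cyl n x) := by
  rw [cyl_eq_preimage]
  exact isClopen_preimage_res n _

theorem measurableSet_cyl (n : ℕ) (x : ℕ → Fin m) : MeasurableSet (cyl n x) :=
  (isClopen_cyl n x).isOpen.measurableSet

theorem exists_cyl_subset {U : Set (ℕ → Fin m)} (hU : IsOpen U) {x : ℕ → Fin m} (hx : x ∈ U) :
    ∃ n, cyl n x ⊆ U := by
  obtain ⟨_, ⟨y, n, rfl⟩, hxy, hyU⟩ :=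
    (PiNat.isTopologicalBasis_cylinders (fun _ : ℕ => Fin m)).exists_subset_of_mem_open hx hU
  refine ⟨n, fun z hz => hyU fun i hi => ?_⟩
  rw [hz i hi, hxy i hi]

/-- Finite measures on the full shift can be compared on cylinders. -/
theorem le_of_forall_cyl_le {μ ν : Measure (ℕ → Fin m)} [IsFiniteMeasure ν]
    (h : ∀ x, ∀ n, 1 ≤ n → μ (cyl n x) ≤ ν (cyl n x)) : μ ≤ ν := by
  have hfin : ∀ n, 1 ≤ n → ∀ T : Set (Fin n → Fin m), μ (res n ⁻¹' T) ≤ ν (res n ⁻¹' T) := by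
    intro n hn T
    have hm := (continuous_res (m := m) n).measurable
    rw [← Measure.map_apply hm T.toFinite.measurableSet,
      ← Measure.map_apply hm T.toFinite.measurableSet, ← T.toFinite.coe_toFinset,
      ← sum_measure_singleton, ← sum_measure_singleton]
    refine Finset.sum_le_sum fun w _ => ?_
    rw [Measure.map_apply hm (measurableSet_singleton w),
      Measure.map_apply hm (measurableSet_singleton w)]
    by_cases hw : ∃ x, res n x = w
    · obtain ⟨x, rfl⟩ := hw
      rw [← cyl_eq_preimage]
      exact h x n hn
    · have : (res n ⁻¹' {w} : Set (ℕ → Fin m)) = ∅ :=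
        Set.eq_empty_of_forall_notMem fun x hx => hw ⟨x, hx⟩
      simp [this]
  have hopen : ∀ U : Set (ℕ → Fin m), IsOpen U → μ U ≤ ν U := by
    intro U hU
    set V : ℕ → Set (ℕ → Fin m) := fun n => {x | cyl (n + 1) x ⊆ U}
    have hV : ∀ n, V n = res (n + 1) ⁻¹' {w | res (n + 1) ⁻¹' {w} ⊆ U} := by
      intro n
      ext x
      simp [V, cyl_eq_preimage]
    have hmono : Monotone V := fun a b hab x hx y hy => hx fun i hi => hy i (by omega)
    have hUV : U = ⋃ n, V n := by
      refine Set.Subset.antisymm (fun x hx => ?_) ?_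
      · obtain ⟨n, hn⟩ := exists_cyl_subset hU hx
        exact Set.mem_iUnion.2 ⟨n, fun y hy => hn fun i hi => hy i (by omega)⟩
      · exact Set.iUnion_subset fun n x hx => hx (mem_cyl_self _ x)
    rw [hUV, hmono.measure_iUnion]
    refine iSup_le fun n => (?_ : μ (V n) ≤ ν (V n)).trans (measure_mono (Set.subset_iUnion V n))
    rw [hV]
    exact hfin (n + 1) (by omega) _
  refine Measure.le_iff.2 fun s hs => ?_
  rw [s.measure_eq_iInf_isOpen ν]
  exact le_iInf₂ fun U hsU => le_iInf fun hU => (measure_mono hsU).trans (hopen U hU)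

theorem eq_of_forall_cyl_eq {μ ν : Measure (ℕ → Fin m)} [IsFiniteMeasure μ] [IsFiniteMeasure ν]
    (h : ∀ x, ∀ n, 1 ≤ n → μ (cyl n x) = ν (cyl n x)) : μ = ν :=
  le_antisymm (le_of_forall_cyl_le fun x n hn => (h x n hn).le)
    (le_of_forall_cyl_le fun x n hn => (h x n hn).ge)

/-- The weighted sum of Dirac masses at the points of period `n`. -/
noncomputable def orbitMeasure (S : Set (ℕ → Fin m)) (φ : (ℕ → Fin m) → ℝ) (n : ℕ) :
    Measure (ℕ → Fin m) :=
  ∑ z ∈ periodic S n, ENNReal.ofReal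
    (Real.exp (birkhoff φ n z) / ∑ y ∈ periodic S n, Real.exp (birkhoff φ n y)) • Measure.dirac z

theorem orbitMeasure_apply (S : Set (ℕ → Fin m)) (φ : (ℕ → Fin m) → ℝ) (n : ℕ)
    {E : Set (ℕ → Fin m)} [DecidablePred (· ∈ E)] (hE : MeasurableSet E) :
    orbitMeasure S φ n E = ENNReal.ofReal ((∑ z ∈ periodic S n with z ∈ E,
      Real.exp (birkhoff φ n z)) / ∑ y ∈ periodic S n, Real.exp (birkhoff φ n y)) := by
  have hnn : 0 ≤ ∑ y ∈ periodic S n, Real.exp (birkhoff φ n y) :=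
    Finset.sum_nonneg fun _ _ => (Real.exp_pos _).le
  rw [orbitMeasure, Measure.finsetSum_apply, Finset.sum_div, ENNReal.ofReal_sum_of_nonneg
    (fun _ _ => div_nonneg (Real.exp_pos _).le hnn), Finset.sum_filter]
  refine Finset.sum_congr rfl fun z _ => ?_
  rw [Measure.smul_apply, Measure.dirac_apply' _ hE, smul_eq_mul]
  by_cases hz : z ∈ E <;> simp [hz]

theorem isProbabilityMeasure_orbitMeasure {S : Set (ℕ → Fin m)} {φ : (ℕ → Fin m) → ℝ} {n : ℕ}
    (h : 0 < ∑ y ∈ periodic S n, Real.exp (birkhoff φ n y)) :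
    IsProbabilityMeasure (orbitMeasure S φ n) := by
  classical
  constructor
  rw [orbitMeasure_apply S φ n MeasurableSet.univ]
  simp [div_self h.ne']

theorem shift_shift (a b : ℕ) (z : ℕ → Fin m) : shift a (shift b z) = shift (a + b) z := by
  funext j
  simp only [shift]
  congr 1
  omega

theorem birkhoff_shift_one {φ : (ℕ → Fin m) → ℝ} {n : ℕ} {z : ℕ → Fin m} (hz : shift n z = z) :
    birkhoff φ n (shift 1 z) = birkhoff φ n z := by
  have h1 := birkhoff_add φ 1 n z
  have h2 := birkhoff_add φ n 1 z
  rw [hz, add_comm n 1] at h2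
  linarith

theorem orbitMeasure_preimage_shift {S : Set (ℕ → Fin m)} (φ : (ℕ → Fin m) → ℝ)
    (hS : ∀ x ∈ S, ∀ n, shift n x ∈ S) (n : ℕ) {E : Set (ℕ → Fin m)} (hE : MeasurableSet E) :
    orbitMeasure S φ n (shift 1 ⁻¹' E) = orbitMeasure S φ n E := by
  classical
  rw [orbitMeasure_apply S φ n hE,
    orbitMeasure_apply S φ n ((continuous_shift 1).measurable hE)]
  congr 2
  have hmem : ∀ k, ∀ z ∈ periodic S n, shift k z ∈ periodic S n := by
    intro k z hz
    obtain ⟨hzS, hn, hper⟩ := mem_periodic.1 hz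
    refine mem_periodic.2 ⟨hS z hzS k, hn, ?_⟩
    rw [shift_shift, add_comm, ← shift_shift, hper]
  have hinv : ∀ z ∈ periodic S n, shift (n - 1) (shift 1 z) = z := by
    intro z hz
    obtain ⟨-, hn, hper⟩ := mem_periodic.1 hz
    rw [shift_shift, Nat.sub_add_cancel hn, hper]
  have hinv' : ∀ z ∈ periodic S n, shift 1 (shift (n - 1) z) = z := by
    intro z hz
    rw [shift_shift, add_comm, ← shift_shift, hinv z hz]
  refine Finset.sum_nbij' (shift 1) (shift (n - 1)) ?_ ?_ ?_ ?_ ?_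
  · intro z hz
    obtain ⟨hz, hzE⟩ := Finset.mem_filter.1 hz
    exact Finset.mem_filter.2 ⟨hmem 1 z hz, hzE⟩
  · intro z hz
    obtain ⟨hz, hzE⟩ := Finset.mem_filter.1 hz
    refine Finset.mem_filter.2 ⟨hmem _ z hz, ?_⟩
    rw [Set.mem_preimage, hinv' z hz]
    exact hzE
  · exact fun z hz => hinv z (Finset.mem_filter.1 hz).1
  · exact fun z hz => hinv' z (Finset.mem_filter.1 hz).1
  · intro z hz
    rw [birkhoff_shift_one (mem_periodic.1 (Finset.mem_filter.1 hz).1).2.2]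

theorem periodicPartition_zero (S : Set (ℕ → Fin m)) (φ : (ℕ → Fin m) → ℝ) (x : ℕ → Fin m)
    (n : ℕ) : periodicPartition S φ x 0 n = ∑ y ∈ periodic S n, Real.exp (birkhoff φ n y) := by
  simp [periodicPartition]

theorem orbitMeasure_cyl (S : Set (ℕ → Fin m)) (φ : (ℕ → Fin m) → ℝ) (x : ℕ → Fin m)
    (ℓ n : ℕ) : orbitMeasure S φ n (cyl ℓ x) = ENNReal.ofReal
      (periodicPartition S φ x ℓ n / periodicPartition S φ x 0 n) := by
  classical
  rw [orbitMeasure_apply S φ n (measurableSet_cyl ℓ x), periodicPartition_zero, periodicPartition]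
  congr!

/-- The Gibbs property with additive constants in the exponent. -/
def IsGibbs (S : Set (ℕ → Fin m)) (φ : (ℕ → Fin m) → ℝ) (P c : ℝ)
    (μ : Measure (ℕ → Fin m)) : Prop :=
  ∀ x ∈ S, ∀ n : ℕ, 1 ≤ n →
    ENNReal.ofReal (Real.exp (birkhoff φ n x - n * P - c)) ≤ μ (cyl n x) ∧
    μ (cyl n x) ≤ ENNReal.ofReal (Real.exp (birkhoff φ n x - n * P + c))

namespace Specification

variable {S : Set (ℕ → Fin m)} {φ : (ℕ → Fin m) → ℝ} {N : ℕ} {D K P : ℝ}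

theorem exists_orbitMeasure_cyl_bound (hS : Specification S φ N D K)
    (hP : Tendsto (fun n : ℕ => (n : ℝ)⁻¹ * Real.log (partition S φ n)) atTop (nhds P)) :
    ∃ c : ℝ, ∀ x ∈ S, ∀ ℓ n : ℕ, ℓ + 2 * N + 1 ≤ n →
      ENNReal.ofReal (Real.exp (birkhoff φ ℓ x - ℓ * P - c)) ≤ orbitMeasure S φ n (cyl ℓ x) ∧
      orbitMeasure S φ n (cyl ℓ x) ≤
        ENNReal.ofReal (Real.exp (birkhoff φ ℓ x - ℓ * P + c)) := by
  obtain ⟨c, hc⟩ := hS.exists_periodicPartition_bound hP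
  refine ⟨2 * c, fun x hx ℓ n hn => ?_⟩
  obtain ⟨h1, h2⟩ := hc x hx ℓ n hn
  obtain ⟨h3, h4⟩ := hc x hx 0 n (by omega)
  have hb : birkhoff φ 0 x = 0 := by simp [birkhoff]
  rw [hb] at h3 h4
  have hpos := (Real.exp_pos _).trans_le h3
  rw [orbitMeasure_cyl]
  constructor
  · refine ENNReal.ofReal_le_ofReal ((le_div_iff₀ hpos).2 ?_)
    refine (mul_le_mul_of_nonneg_left h4 (Real.exp_pos _).le).trans (le_trans (le_of_eq ?_) h1)
    rw [← Real.exp_add]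
    congr 1
    push_cast
    ring
  · refine ENNReal.ofReal_le_ofReal ((div_le_iff₀ hpos).2 ?_)
    refine h2.trans (le_trans (le_of_eq ?_) (mul_le_mul_of_nonneg_left h3 (Real.exp_pos _).le))
    rw [← Real.exp_add]
    congr 1
    push_cast
    ring

theorem sum_periodic_pos (hS : Specification S φ N D K) {n : ℕ} (hn : 2 * N + 1 ≤ n) :
    0 < ∑ y ∈ periodic S n, Real.exp (birkhoff φ n y) := by
  obtain ⟨x, hx⟩ := hS.nonempty
  obtain ⟨z, hz, -, hper⟩ := hS.close x hx (n - N) (by omega)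
  rw [Nat.sub_add_cancel (by omega)] at hper
  exact Finset.sum_pos (fun _ _ => Real.exp_pos _) ⟨z, mem_periodic.2 ⟨hz, by omega, hper⟩⟩

/-- Existence of an invariant Gibbs measure, as a limit of measures on periodic orbits. -/
theorem exists_gibbs (hS : Specification S φ N D K)
    (hP : Tendsto (fun n : ℕ => (n : ℝ)⁻¹ * Real.log (partition S φ n)) atTop (nhds P)) :
    ∃ μ : Measure (ℕ → Fin m), IsProbabilityMeasure μ ∧ μ Sᶜ = 0 ∧
      MeasurePreserving (shift 1) μ μ ∧ ∃ c, IsGibbs S φ P c μ := by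
  classical
  obtain ⟨c, hc⟩ := hS.exists_orbitMeasure_cyl_bound hP
  set ν : ℕ → ProbabilityMeasure (ℕ → Fin m) := fun n => ⟨orbitMeasure S φ (n + 2 * N + 1),
    isProbabilityMeasure_orbitMeasure (hS.sum_periodic_pos (by omega))⟩
  obtain ⟨μ, -, hμ⟩ := isCompact_univ.ultrafilter_le_nhds ((hyperfilter ℕ).map ν)
    (by simp)
  have hμ : Tendsto ν (hyperfilter ℕ) (nhds μ) := hμ
  have hlim : ∀ E : Set (ℕ → Fin m), IsClopen E →
      Tendsto (fun n => orbitMeasure S φ (n + 2 * N + 1) E) (hyperfilter ℕ)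
        (nhds ((μ : Measure (ℕ → Fin m)) E)) := fun E hE =>
    ProbabilityMeasure.tendsto_measure_of_null_frontier_of_tendsto' hμ (by simp [hE.frontier_eq])
  refine ⟨μ, inferInstance, ?_, ⟨(continuous_shift 1).measurable, ?_⟩, c, fun x hx ℓ _ => ?_⟩
  · have hzero : ∀ n, (ν n : Measure (ℕ → Fin m)) Sᶜ = 0 := by
      intro n
      refine (orbitMeasure_apply _ _ _ hS.isClosed.isOpen_compl.measurableSet).trans ?_
      refine (congrArg (fun t => ENNReal.ofReal (t / _))
        (Finset.sum_eq_zero fun z hz => ?_)).trans (by simp)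
      exact absurd (mem_periodic.1 (Finset.mem_filter.1 hz).1).1 (Finset.mem_filter.1 hz).2
    have := ProbabilityMeasure.le_liminf_measure_open_of_tendsto hμ hS.isClosed.isOpen_compl
    simpa [hzero] using this
  · have : IsProbabilityMeasure ((μ : Measure (ℕ → Fin m)).map (shift 1)) :=
      Measure.isProbabilityMeasure_map (continuous_shift 1).measurable.aemeasurable
    refine eq_of_forall_cyl_eq fun x n _ => ?_
    rw [Measure.map_apply (continuous_shift 1).measurable (measurableSet_cyl n x)]
    refine tendsto_nhds_unique (hlim _ ((isClopen_cyl n x).preimage (continuous_shift 1))) ?_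
    simp only [orbitMeasure_preimage_shift φ hS.shift_mem _ (measurableSet_cyl n x)]
    exact hlim _ (isClopen_cyl n x)
  · have hev : ∀ᶠ n in (hyperfilter ℕ : Filter ℕ), ℓ ≤ n :=
      (Nat.hyperfilter_le_atTop (eventually_ge_atTop ℓ))
    exact ⟨ge_of_tendsto (hlim _ (isClopen_cyl ℓ x))
        (hev.mono fun n hn => (hc x hx ℓ _ (by omega)).1),
      le_of_tendsto (hlim _ (isClopen_cyl ℓ x))
        (hev.mono fun n hn => (hc x hx ℓ _ (by omega)).2)⟩

end Specification

theorem exists_mem_cyl_of_ne_zero {S : Set (ℕ → Fin m)} {μ : Measure (ℕ → Fin m)}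
    (hμS : μ Sᶜ = 0) {n : ℕ} {x : ℕ → Fin m} (h : μ (cyl n x) ≠ 0) : ∃ y ∈ S, y ∈ cyl n x := by
  by_contra! hcon
  exact h (measure_mono_null (fun y hy hyS => hcon y hyS hy) hμS)

namespace Specification

variable {S : Set (ℕ → Fin m)} {φ : (ℕ → Fin m) → ℝ} {N : ℕ} {D K P : ℝ}

/-- Quasi-Bernoulli lower bound for Gibbs measures. -/
theorem mul_le_measure_inter (hS : Specification S φ N D K) {μ : Measure (ℕ → Fin m)} {c : ℝ}
    (hμS : μ Sᶜ = 0) (hμ : IsGibbs S φ P c μ) (x y : ℕ → Fin m) {n k : ℕ} (hn : 1 ≤ n)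
    (hk : 1 ≤ k) :
    ENNReal.ofReal (Real.exp (-(3 * c + N * K + N * P))) * μ (cyl n x) * μ (cyl k y) ≤
      μ (cyl n x ∩ shift (n + N) ⁻¹' cyl k y) := by
  by_cases hx : μ (cyl n x) = 0
  · simp [hx]
  by_cases hy : μ (cyl k y) = 0
  · simp [hy]
  obtain ⟨x', hx', hxx⟩ := exists_mem_cyl_of_ne_zero hμS hx
  obtain ⟨y', hy', hyy⟩ := exists_mem_cyl_of_ne_zero hμS hy
  rw [← cyl_eq_of_mem hxx, ← cyl_eq_of_mem hyy]
  obtain ⟨z, hz, hzx, hzy⟩ := hS.glue x' hx' y' hy' n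
  rw [← cyl_eq_of_mem hzx]
  have hsub : cyl (n + N + k) z ⊆ cyl n z ∩ shift (n + N) ⁻¹' cyl k y' := by
    refine fun u hu => ⟨fun i hi => hu i (by omega), fun i hi => ?_⟩
    rw [← hzy]
    exact hu (i + (n + N)) (by omega)
  refine le_trans ?_ (((hμ z hz (n + N + k) (by omega)).1).trans (measure_mono hsub))
  refine (mul_le_mul' (mul_le_mul' le_rfl (hμ z hz n hn).2) (hμ y' hy' k hk).2).trans ?_
  rw [← ENNReal.ofReal_mul (Real.exp_pos _).le, ← ENNReal.ofReal_mul (by positivity),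
    ← Real.exp_add, ← Real.exp_add]
  refine ENNReal.ofReal_le_ofReal (Real.exp_le_exp.2 ?_)
  have h := abs_le.1 (hS.abs_birkhoff_le (hS.shift_mem z hz n) N)
  rw [birkhoff_add, birkhoff_add, hzy]
  push_cast
  linarith [h.1]

theorem ergodic_of_isGibbs (hS : Specification S φ N D K) {μ : Measure (ℕ → Fin m)}
    [IsProbabilityMeasure μ] {c : ℝ} (hμS : μ Sᶜ = 0) (hinv : MeasurePreserving (shift 1) μ μ)
    (hμ : IsGibbs S φ P c μ) : Ergodic (shift 1) μ := by
  refine ⟨hinv, ⟨fun {E} hE hEinv => ?_⟩⟩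
  have hpre : ∀ k, shift k ⁻¹' E = E := by
    intro k
    induction k with
    | zero => rfl
    | succ k ih =>
      have : (shift (k + 1) : (ℕ → Fin m) → ℕ → Fin m) = shift k ∘ shift 1 :=
        funext fun z => (shift_shift k 1 z).symm
      rw [this, Set.preimage_comp, ih, hEinv]
  set δ := ENNReal.ofReal (Real.exp (-(3 * c + N * K + N * P)))
  have hδ : δ ≠ 0 := by simp [δ, Real.exp_pos]
  have hcyl : ∀ x, ∀ n, 1 ≤ n → δ * μ (cyl n x) * μ E ≤ μ (cyl n x ∩ E) := by
    intro x n hn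
    have hmeas := (continuous_shift (m := m) (n + N)).measurable
    have hle : (δ * μ (cyl n x)) • μ ≤ (μ.restrict (cyl n x)).map (shift (n + N)) := by
      refine le_of_forall_cyl_le fun y k hk => ?_
      rw [Measure.map_apply hmeas (measurableSet_cyl k y),
        Measure.restrict_apply (hmeas (measurableSet_cyl k y)), Set.inter_comm]
      exact hS.mul_le_measure_inter hμS hμ x y hn hk
    have := hle E
    rwa [Measure.map_apply hmeas hE, hpre, Measure.restrict_apply hE, Set.inter_comm] at this
  have hle : (δ * μ E) • μ ≤ μ.restrict E := by
    refine le_of_forall_cyl_le fun x n hn => ?_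
    rw [Measure.restrict_apply (measurableSet_cyl n x), Measure.smul_apply, smul_eq_mul,
      mul_right_comm]
    exact hcyl x n hn
  have h0 := hle Eᶜ
  rw [Measure.restrict_apply hE.compl, Set.compl_inter_self, measure_empty, Measure.smul_apply,
    smul_eq_mul, nonpos_iff_eq_zero, mul_eq_zero, mul_eq_zero] at h0
  rw [Filter.eventuallyConst_set']
  rcases h0 with (h0 | h0) | h0
  · exact absurd h0 hδ
  · exact Or.inl (ae_eq_empty.2 h0)
  · exact Or.inr (ae_eq_univ.2 h0)

end Specification

theorem IsGibbs.absolutelyContinuous {S : Set (ℕ → Fin m)} {φ : (ℕ → Fin m) → ℝ} {P c c' : ℝ}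
    {μ ν : Measure (ℕ → Fin m)} [IsFiniteMeasure μ] (hν : IsGibbs S φ P c' ν)
    (hμ : IsGibbs S φ P c μ) (hνS : ν Sᶜ = 0) : ν ≪ μ := by
  refine Measure.absolutelyContinuous_of_le_smul
    (c := ENNReal.ofReal (Real.exp (c + c'))) ?_
  have : IsFiniteMeasure (ENNReal.ofReal (Real.exp (c + c')) • μ) :=
    μ.smul_finite ENNReal.ofReal_ne_top
  refine le_of_forall_cyl_le fun x n hn => ?_
  by_cases hx : ν (cyl n x) = 0
  · simp [hx]
  obtain ⟨y, hy, hyx⟩ := exists_mem_cyl_of_ne_zero hνS hx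
  rw [← cyl_eq_of_mem hyx, Measure.smul_apply, smul_eq_mul]
  refine ((hν y hy n hn).2).trans (le_trans ?_ (mul_le_mul' le_rfl (hμ y hy n hn).1))
  rw [← ENNReal.ofReal_mul (Real.exp_pos _).le, ← Real.exp_add]
  refine ENNReal.ofReal_le_ofReal (Real.exp_le_exp.2 ?_)
  linarith

theorem measure_setOf_mem_and {S : Set (ℕ → Fin m)} {μ : Measure (ℕ → Fin m)} (hμS : μ Sᶜ = 0)
    (x : ℕ → Fin m) (n : ℕ) : μ {y ∈ S | ∀ k < n, y k = x k} = μ (cyl n x) := by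
  change μ (S ∩ cyl n x) = _
  rw [Set.inter_comm]
  exact measure_inter_conull hμS

theorem gibbsProp_iff {A : Matrix (Fin m) (Fin m) ℕ} {φ : (ℕ → Fin m) → ℝ} {P : ℝ}
    {μ : Measure (ℕ → Fin m)} [IsFiniteMeasure μ] (hμS : μ (SigA A)ᶜ = 0) :
    GibbsProp A φ P μ ↔ ∃ c, IsGibbs (SigA A) φ P c μ := by
  have hexp : ∀ (n : ℕ) (x : ℕ → Fin m), Real.exp (-(n : ℝ) * P +
      ∑ k ∈ Finset.range n, φ (fun j => x (j + k))) = Real.exp (birkhoff φ n x - n * P) := by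
    intro n x
    congr 1
    simp only [birkhoff]
    unfold shift
    ring
  simp only [GibbsProp, IsGibbs, measure_setOf_mem_and hμS, hexp,
    ENNReal.ofReal_le_iff_le_toReal (measure_ne_top μ _),
    ENNReal.le_ofReal_iff_toReal_le (measure_ne_top μ _) (Real.exp_pos _).le,
    le_div_iff₀ (Real.exp_pos _), div_le_iff₀ (Real.exp_pos _)]
  constructor
  · rintro ⟨c₁, c₂, h₁, h₂, h⟩
    refine ⟨max (-Real.log c₁) (Real.log c₂), fun x hx n hn => ⟨?_, ?_⟩⟩
    · refine le_trans ?_ (h x hx n hn).1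
      nth_rw 2 [← Real.exp_log h₁]
      rw [← Real.exp_add]
      exact Real.exp_le_exp.2 (by linarith [le_max_left (-Real.log c₁) (Real.log c₂)])
    · refine (h x hx n hn).2.trans ?_
      nth_rw 1 [← Real.exp_log h₂]
      rw [← Real.exp_add]
      exact Real.exp_le_exp.2 (by linarith [le_max_right (-Real.log c₁) (Real.log c₂)])
  · rintro ⟨c, h⟩
    refine ⟨Real.exp (-c), Real.exp c, Real.exp_pos _, Real.exp_pos _, fun x hx n hn => ?_⟩
    rw [← Real.exp_add, ← Real.exp_add, neg_add_eq_sub, add_comm c]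
    exact h x hx n hn

theorem exists_path {A : Matrix (Fin m) (Fin m) ℕ} (h01 : ∀ i j, A i j = 0 ∨ A i j = 1) :
    ∀ (n : ℕ) (i j : Fin m), 0 < (A ^ n) i j →
      ∃ p : ℕ → Fin m, p 0 = i ∧ p n = j ∧ ∀ k < n, A (p k) (p (k + 1)) = 1 := by
  intro n
  induction n with
  | zero =>
    intro i j h
    refine ⟨fun _ => i, rfl, ?_, by simp⟩
    by_contra hij
    simp [Matrix.one_apply_ne hij] at h
  | succ n ih =>
    intro i j h
    rw [pow_succ', Matrix.mul_apply] at h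
    obtain ⟨k, -, hk⟩ := Finset.exists_ne_zero_of_sum_ne_zero h.ne'
    obtain ⟨p, hp0, hpn, hp⟩ := ih k j (Nat.pos_of_ne_zero (right_ne_zero_of_mul hk))
    refine ⟨fun t => if t = 0 then i else p (t - 1), by simp, by simpa using hpn, ?_⟩
    rintro (_ | t) ht
    · simpa [hp0] using (h01 i k).resolve_left (left_ne_zero_of_mul hk)
    · simpa using hp t (by omega)

theorem sigA_nonempty (hm : 1 ≤ m) {A : Matrix (Fin m) (Fin m) ℕ}
    (h01 : ∀ i j, A i j = 0 ∨ A i j = 1) {N : ℕ} (hN : 0 < N)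
    (hprim : ∀ i j, 0 < (A ^ N) i j) : (SigA A).Nonempty := by
  have hs : ∀ i, ∃ j, A i j = 1 := by
    intro i
    obtain ⟨p, hp0, -, hp⟩ := exists_path h01 N i i (hprim i i)
    exact ⟨p 1, hp0 ▸ hp 0 hN⟩
  choose s hs using hs
  refine ⟨fun n => s^[n] ⟨0, hm⟩, fun k => ?_⟩
  change A (s^[k] _) (s^[k + 1] _) = 1
  rw [Function.iterate_succ_apply']
  exact hs _

theorem sigA_glue {A : Matrix (Fin m) (Fin m) ℕ} (h01 : ∀ i j, A i j = 0 ∨ A i j = 1) {N : ℕ}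
    (hprim : ∀ i j, 0 < (A ^ (N + 1)) i j) {x y : ℕ → Fin m} (hx : x ∈ SigA A)
    (hy : y ∈ SigA A) (n : ℕ) :
    ∃ z ∈ SigA A, (∀ j < n, z j = x j) ∧ shift (n + N) z = y := by
  obtain ⟨p, hp0, hpN, hp⟩ := exists_path h01 (N + 1) (x (n - 1)) (y 0) (hprim _ _)
  refine ⟨fun j => if j < n then x j else if j < n + N then p (j - n + 1) else y (j - (n + N)),
    fun k => ?_, fun j hj => by simp [hj],
    funext fun j => by simp [shift, show ¬ j + (n + N) < n by omega]⟩
  rcases lt_trichotomy (k + 1) n with h | h | h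
  · simpa [h, show k < n by omega] using hx k
  · have hk : x k = p 0 := by rw [hp0, ← h]; rfl
    rcases Nat.eq_zero_or_pos N with rfl | hN
    · simpa [← h, hk, ← hpN] using hp 0 (by omega)
    · simpa [← h, hk, hN] using hp 0 (by omega)
  · rcases lt_trichotomy (k + 1) (n + N) with h' | h' | h'
    · have := hp (k - n + 1) (by omega)
      beta_reduce
      rw [if_neg (by omega), if_pos (by omega), if_neg (by omega), if_pos h',
        show k + 1 - n + 1 = k - n + 1 + 1 by omega]
      exact this
    · have := hp N (by omega)
      beta_reduce
      rw [if_neg (by omega), if_pos (by omega), if_neg (by omega), if_neg (by omega), h',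
        Nat.sub_self, ← hpN, show k - n + 1 = N by omega]
      exact this
    · beta_reduce
      rw [if_neg (by omega), if_neg (by omega), if_neg (by omega), if_neg (by omega),
        show k + 1 - (n + N) = k - (n + N) + 1 by omega]
      exact hy _

theorem sigA_close {A : Matrix (Fin m) (Fin m) ℕ} (h01 : ∀ i j, A i j = 0 ∨ A i j = 1) {N : ℕ}
    (hprim : ∀ i j, 0 < (A ^ (N + 1)) i j) {x : ℕ → Fin m} (hx : x ∈ SigA A) {n : ℕ}
    (hn : 0 < n) :
    ∃ z ∈ SigA A, (∀ j < n, z j = x j) ∧ shift (n + N) z = z := by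
  obtain ⟨p, hp0, hpN, hp⟩ := exists_path h01 (N + 1) (x (n - 1)) (x 0) (hprim _ _)
  set q : ℕ → Fin m := fun j => if j < n then x j else p (j - n + 1) with hq
  have hstep : ∀ j < n + N, A (q j) (q (j + 1)) = 1 := by
    intro j hj
    rcases lt_trichotomy (j + 1) n with h | h | h
    · simpa [hq, h, show j < n by omega] using hx j
    · have hk : x j = p 0 := by rw [hp0, ← h]; rfl
      simpa [hq, ← h, hk] using hp 0 (by omega)
    · have := hp (j - n + 1) (by omega)
      simp only [hq]
      rw [if_neg (by omega), if_neg (by omega), show j + 1 - n + 1 = j - n + 1 + 1 by omega]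
      exact this
  have hend : q (n + N) = q 0 := by
    simp only [hq]
    rw [if_neg (by omega), if_pos hn, show n + N - n + 1 = N + 1 by omega, hpN]
  refine ⟨fun j => q (j % (n + N)), fun k => ?_, fun j hj => ?_, funext fun j => by simp [shift]⟩
  · have hlt := Nat.mod_lt k (show 0 < n + N by omega)
    have h := hstep _ hlt
    change A (q (k % (n + N))) (q ((k + 1) % (n + N))) = 1
    have h1 : q ((k + 1) % (n + N)) = q (k % (n + N) + 1) := by
      rw [← Nat.mod_add_mod]
      rcases (Nat.succ_le_of_lt hlt).lt_or_eq with h' | h'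
      · rw [Nat.mod_eq_of_lt h']
      · rw [show k % (n + N) + 1 = n + N from h', Nat.mod_self, hend]
    rw [h1]
    exact h
  · simp [Nat.mod_eq_of_lt (show j < n + N by omega), hq, hj]

theorem isClosed_sigA (A : Matrix (Fin m) (Fin m) ℕ) : IsClosed (SigA A) := by
  have : SigA A = ⋂ k, {x : ℕ → Fin m | A (x k) (x (k + 1)) = 1} := by
    ext x
    simp [SigA]
  rw [this]
  refine isClosed_iInter fun k => ?_
  exact (isClosed_discrete {q : Fin m × Fin m | A q.1 q.2 = 1}).preimage
    (f := fun x : ℕ → Fin m => (x k, x (k + 1)))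
    ((continuous_apply k).prodMk (continuous_apply (k + 1)))

theorem shift_mem_sigA {A : Matrix (Fin m) (Fin m) ℕ} {x : ℕ → Fin m} (hx : x ∈ SigA A) (n : ℕ) :
    shift n x ∈ SigA A := fun k => by
  simpa [shift, add_right_comm] using hx (k + n)

theorem exists_abs_le {S : Set (ℕ → Fin m)} {φ : (ℕ → Fin m) → ℝ} {b : ℝ}
    (h : ∀ x ∈ S, ∀ y ∈ S, x 0 = y 0 → |φ x - φ y| ≤ b) : ∃ K, ∀ x ∈ S, |φ x| ≤ K := by
  have hletter : ∀ a, ∃ K, ∀ x ∈ S, x 0 = a → |φ x| ≤ K := by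
    intro a
    by_cases ha : ∃ y ∈ S, y 0 = a
    · obtain ⟨y, hy, rfl⟩ := ha
      refine ⟨|φ y| + b, fun x hx hxy => ?_⟩
      have h1 := h x hx y hy hxy
      have h2 := abs_sub_abs_le_abs_sub (φ x) (φ y)
      linarith
    · exact ⟨0, fun x hx hxa => absurd ⟨x, hx, hxa⟩ ha⟩
  choose K hK using hletter
  obtain ⟨M, hM⟩ := Finite.exists_le K
  exact ⟨M, fun x hx => (hK _ x hx rfl).trans (hM _)⟩

theorem birkhoff_le_add_of_holder {S : Set (ℕ → Fin m)} {φ : (ℕ → Fin m) → ℝ} {b α : ℝ}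
    (hS : ∀ x ∈ S, ∀ n, shift n x ∈ S) (hb : 0 < b) (hα : α ∈ Ioo (0 : ℝ) 1)
    (h : ∀ k : ℕ, ∀ x ∈ S, ∀ y ∈ S, (∀ ℓ ≤ k, x ℓ = y ℓ) → |φ x - φ y| ≤ b * α ^ k)
    (n : ℕ) {x y : ℕ → Fin m} (hx : x ∈ S) (hy : y ∈ S) (hxy : ∀ i < n, x i = y i) :
    birkhoff φ n x ≤ birkhoff φ n y + b * (1 - α)⁻¹ := by
  have h1 : birkhoff φ n x - birkhoff φ n y ≤ ∑ k ∈ Finset.range n, b * α ^ (n - 1 - k) := by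
    rw [birkhoff, birkhoff, ← Finset.sum_sub_distrib]
    refine Finset.sum_le_sum fun k hk => (le_abs_self _).trans ?_
    have hk := Finset.mem_range.1 hk
    exact h _ _ (hS x hx k) _ (hS y hy k) fun ℓ hℓ => hxy _ (by omega)
  rw [Finset.sum_range_reflect (fun k => b * α ^ k) n, ← Finset.mul_sum] at h1
  have h2 : ∑ k ∈ Finset.range n, α ^ k ≤ (1 - α)⁻¹ := by
    rw [← tsum_geometric_of_lt_one hα.1.le hα.2]
    exact (summable_geometric_of_lt_one hα.1.le hα.2).sum_le_tsum _
      fun k _ => pow_nonneg hα.1.le k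
  have h3 := mul_le_mul_of_nonneg_left h2 hb.le
  linarith

theorem sum_indicator_eq_partition (S : Set (ℕ → Fin m)) (φ : (ℕ → Fin m) → ℝ) (n : ℕ) :
    ∑ w : Fin n → Fin m,
      Set.indicator {w : Fin n → Fin m | ∃ x ∈ S, ∀ k : Fin n, x (k : ℕ) = w k}
        (fun w => Real.exp (sSup ((fun x : ℕ → Fin m =>
            ∑ k ∈ Finset.range n, φ (fun j => x (j + k))) ''
          {x ∈ S | ∀ k : Fin n, x (k : ℕ) = w k}))) w = partition S φ n := by
  classical
  have hres : ∀ (x : ℕ → Fin m) (w : Fin n → Fin m), (∀ k : Fin n, x k = w k) ↔ res n x = w :=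
    fun x w => funext_iff.symm
  simp only [hres]
  rw [partition, ← Finset.sum_subset (Finset.subset_univ (words S n))]
  · refine Finset.sum_congr rfl fun w hw => ?_
    rw [Set.indicator_of_mem (show w ∈ {w | ∃ x ∈ S, res n x = w} from mem_words.1 hw)]
    rfl
  · intro w _ hw
    exact Set.indicator_of_notMem (s := {w | ∃ x ∈ S, res n x = w})
      (fun h => hw (mem_words.2 h)) _

end SubshiftGibbs

theorem stmt18 {m : ℕ} (hm : 1 ≤ m) (A : Matrix (Fin m) (Fin m) ℕ)
    (h01 : ∀ i j, A i j = 0 ∨ A i j = 1)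
    -- primitivity
    (hprim : ∃ N : ℕ, 0 < N ∧ ∀ i j, 0 < (A ^ N) i j)
    -- a Hölder continuous potential on Σ_A
    (φ : (ℕ → Fin m) → ℝ)
    (hHolder : ∃ b > (0:ℝ), ∃ α ∈ Ioo (0:ℝ) 1, ∀ k : ℕ, ∀ ω ∈ SigA A, ∀ τ ∈ SigA A,
      (∀ ℓ ≤ k, ω ℓ = τ ℓ) → |φ ω - φ τ| ≤ b * α ^ k)
    -- the topological pressure of φ
    (P : ℝ)
    (hP : Tendsto (fun n : ℕ => (n : ℝ)⁻¹ * Real.log (∑ w : Fin n → Fin m,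
        Set.indicator {w : Fin n → Fin m | ∃ ω ∈ SigA A, ∀ k : Fin n, ω (k : ℕ) = w k}
          (fun w => Real.exp (sSup ((fun ω : ℕ → Fin m =>
              ∑ k ∈ Finset.range n, φ (fun j => ω (j + k))) ''
            {ω ∈ SigA A | ∀ k : Fin n, ω (k : ℕ) = w k}))) w))
      atTop (nhds P)) :
    ∃ μ : Measure (ℕ → Fin m),
      (IsProbabilityMeasure μ ∧ μ (SigA A)ᶜ = 0 ∧
        MeasurePreserving (fun ω n => ω (n + 1)) μ μ ∧ GibbsProp A φ P μ) ∧
      (∀ μ' : Measure (ℕ → Fin m),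
        IsProbabilityMeasure μ' → μ' (SigA A)ᶜ = 0 →
          MeasurePreserving (fun ω n => ω (n + 1)) μ' μ' → GibbsProp A φ P μ' → μ' = μ) ∧
      Ergodic (fun ω n => ω (n + 1)) μ := by
  obtain ⟨N, hN, hprim⟩ := hprim
  obtain ⟨b, hb, α, hα, hφ⟩ := hHolder
  have hshift : ∀ x ∈ SigA A, ∀ n, SubshiftGibbs.shift n x ∈ SigA A :=
    fun x hx n => SubshiftGibbs.shift_mem_sigA hx n
  obtain ⟨K, hK⟩ := SubshiftGibbs.exists_abs_le (S := SigA A) (φ := φ) (b := b)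
    fun x hx y hy hxy => by
      simpa using hφ 0 x hx y hy fun ℓ hℓ => by rwa [Nat.le_zero.1 hℓ]
  have hne := SubshiftGibbs.sigA_nonempty hm h01 hN hprim
  obtain ⟨N, rfl⟩ := Nat.exists_eq_add_of_le' hN
  have hS : SubshiftGibbs.Specification (SigA A) φ N (b * (1 - α)⁻¹) K :=
    { isClosed := SubshiftGibbs.isClosed_sigA A
      nonempty := hne
      shift_mem := hshift
      glue := fun x hx y hy n => SubshiftGibbs.sigA_glue h01 hprim hx hy n
      close := fun x hx n hn => SubshiftGibbs.sigA_close h01 hprim hx hn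
      distortion := fun n x hx y hy hxy =>
        SubshiftGibbs.birkhoff_le_add_of_holder hshift hb hα hφ n hx hy hxy
      bounded := hK }
  simp only [SubshiftGibbs.sum_indicator_eq_partition] at hP
  obtain ⟨μ, hμ, hμS, hinv, c, hc⟩ := hS.exists_gibbs hP
  have herg := hS.ergodic_of_isGibbs hμS hinv hc
  refine ⟨μ, ⟨hμ, hμS, hinv, (SubshiftGibbs.gibbsProp_iff hμS).2 ⟨c, hc⟩⟩, ?_, herg⟩
  intro μ' hμ' hμS' hinv' hG
  obtain ⟨c', hc'⟩ := (SubshiftGibbs.gibbsProp_iff hμS').1 hG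
  exact herg.eq_of_absolutelyContinuous hinv' (hc'.absolutelyContinuous hc hμS')
end

section
/- Let T : I → I be a piecewise monotone map of a compact interval I ⊂ ℝ, and let ℓ(T^n) denote the lap number of the n-fold composition T^n, i.e. the number of maximal intervals of monotonicity of T^n. Then the topological entropy of T satisfies h_top(T) = lim_{n→∞} (1/n) log ℓ(T^n). In particular, if T is piecewise affine with constant slope ±s at every non-turning point, then h_top(T) = max{0, log s}. -/
open Filter Set

/-- The lap number of `T` on `[a,b]`: the least number of intervals of a partition
of `[a,b]` on each of which `T` is monotone. -/
noncomputable def lapNum (a b : ℝ) (T : ℝ → ℝ) : ℕ :=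
  sInf {k : ℕ | ∃ x : Fin (k + 1) → ℝ, StrictMono x ∧ x 0 = a ∧ x (Fin.last k) = b ∧
    ∀ j : Fin k, MonotoneOn T (Icc (x j.castSucc) (x j.succ)) ∨
      AntitoneOn T (Icc (x j.castSucc) (x j.succ))}

/-- The maximal cardinality of an `(n,ε)`-separated subset of `K`. -/
noncomputable def sepNum (T : ℝ → ℝ) (K : Set ℝ) (n : ℕ) (ε : ℝ) : ℕ :=
  sSup {k : ℕ | ∃ S : Finset ℝ, ↑S ⊆ K ∧ S.card = k ∧
    ∀ x ∈ S, ∀ y ∈ S, x ≠ y → ∃ i < n, ε ≤ |T^[i] x - T^[i] y|}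

/-- Bowen's topological entropy via `(n,ε)`-separated sets:
`h_top(T) = lim_{ε→0} limsup_n (1/n) log s_n(ε)`. -/
noncomputable def htop (T : ℝ → ℝ) (K : Set ℝ) : ℝ :=
  ⨆ ε : {ε : ℝ // 0 < ε},
    limsup (fun n : ℕ => (n : ℝ)⁻¹ * Real.log (sepNum T K n ε)) atTop

/-- `f` is monotone or antitone on `s`. -/
def MonoOrAntiOn (f : ℝ → ℝ) (s : Set ℝ) : Prop :=
  MonotoneOn f s ∨ AntitoneOn f s

lemma MonoOrAntiOn.mono {f : ℝ → ℝ} {s t : Set ℝ} (h : MonoOrAntiOn f t) (hst : s ⊆ t) :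
    MonoOrAntiOn f s :=
  h.imp (fun h => h.mono hst) fun h => h.mono hst

lemma MonoOrAntiOn.comp {f g : ℝ → ℝ} {s t : Set ℝ} (hg : MonoOrAntiOn g t)
    (hf : MonoOrAntiOn f s) (hst : MapsTo f s t) : MonoOrAntiOn (g ∘ f) s := by
  rcases hg with hg | hg <;> rcases hf with hf | hf
  · exact Or.inl (hg.comp hf hst)
  · exact Or.inr (hg.comp_AntitoneOn hf hst)
  · exact Or.inr (hg.comp_MonotoneOn hf hst)
  · exact Or.inl (hg.comp hf hst)

lemma MonoOrAntiOn.ordConnected_preimage {f : ℝ → ℝ} {s t : Set ℝ} (hf : MonoOrAntiOn f s)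
    (hs : s.OrdConnected) (ht : t.OrdConnected) : (s ∩ f ⁻¹' t).OrdConnected := by
  refine ⟨fun x hx y hy z hz => ?_⟩
  have hzs := hs.out hx.1 hy.1 hz
  refine ⟨hzs, ?_⟩
  rcases hf with hf | hf
  · exact ht.out hx.2 hy.2 ⟨hf hx.1 hzs hz.1, hf hzs hy.1 hz.2⟩
  · exact ht.out hy.2 hx.2 ⟨hf hzs hy.1 hz.2, hf hx.1 hzs hz.1⟩

/-- `C` is a closed subinterval of `[a,b]` on which `f` is monotone or antitone. -/
structure IsMonoPiece (a b : ℝ) (f : ℝ → ℝ) (C : Set ℝ) : Prop where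
  isClosed : IsClosed C
  ordConnected : C.OrdConnected
  subset : C ⊆ Icc a b
  mono : MonoOrAntiOn f C

lemma IsMonoPiece.comp {a b : ℝ} {f g : ℝ → ℝ} {C D : Set ℝ} (hC : IsMonoPiece a b f C)
    (hD : IsMonoPiece a b g D) (hf : ContinuousOn f (Icc a b)) :
    IsMonoPiece a b (g ∘ f) (C ∩ f ⁻¹' D) where
  isClosed := (hf.mono hC.subset).preimage_isClosed_of_isClosed hC.isClosed hD.isClosed
  ordConnected := hC.mono.ordConnected_preimage hC.ordConnected hD.ordConnected
  subset := inter_subset_left.trans hC.subset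
  mono := hD.mono.comp (hC.mono.mono inter_subset_left) fun _ hx => hx.2

/-- `U` is covered by at most `M` closed subintervals of `[a,b]` on each of which `f` is
monotone or antitone. -/
def MonoCovered (a b : ℝ) (f : ℝ → ℝ) (U : Set ℝ) (M : ℕ) : Prop :=
  ∃ 𝒞 : Finset (Set ℝ), 𝒞.card ≤ M ∧ (∀ C ∈ 𝒞, IsMonoPiece a b f C) ∧ U ⊆ ⋃₀ (𝒞 : Set (Set ℝ))

lemma MonoCovered.subset {a b : ℝ} {f : ℝ → ℝ} {U V : Set ℝ} {M : ℕ}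
    (h : MonoCovered a b f V M) (hUV : U ⊆ V) : MonoCovered a b f U M :=
  let ⟨𝒞, h1, h2, h3⟩ := h
  ⟨𝒞, h1, h2, hUV.trans h3⟩

open Classical in
lemma MonoCovered.comp {a b : ℝ} {f g : ℝ → ℝ} {U V : Set ℝ} {M L : ℕ}
    (hU : MonoCovered a b f U M) (hV : MonoCovered a b g V L) (hf : ContinuousOn f (Icc a b)) :
    MonoCovered a b (g ∘ f) (U ∩ f ⁻¹' V) (M * L) := by
  obtain ⟨𝒞, h1, h2, h3⟩ := hU
  obtain ⟨𝒟, k1, k2, k3⟩ := hV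
  refine ⟨(𝒞 ×ˢ 𝒟).image fun p => p.1 ∩ f ⁻¹' p.2, ?_, ?_, ?_⟩
  · refine Finset.card_image_le.trans ?_
    rw [Finset.card_product]
    exact Nat.mul_le_mul h1 k1
  · intro E hE
    obtain ⟨p, hp, rfl⟩ := Finset.mem_image.1 hE
    rw [Finset.mem_product] at hp
    exact (h2 _ hp.1).comp (k2 _ hp.2) hf
  · rintro x ⟨hxU, hxV⟩
    obtain ⟨C, hC, hxC⟩ := h3 hxU
    obtain ⟨D, hD, hxD⟩ := k3 hxV
    exact ⟨C ∩ f ⁻¹' D, Finset.mem_coe.2 (Finset.mem_image.2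
      ⟨(C, D), Finset.mem_product.2 ⟨hC, hD⟩, rfl⟩), hxC, hxD⟩

open Classical in
lemma MonoCovered.biUnion {a b : ℝ} {f : ℝ → ℝ} {S : Finset ℝ} {U : ℝ → Set ℝ} {M : ℕ}
    (h : ∀ z ∈ S, MonoCovered a b f (U z) M) :
    MonoCovered a b f (⋃ z ∈ S, U z) (S.card * M) := by
  choose! 𝒞 h1 h2 h3 using h
  refine ⟨S.biUnion 𝒞, Finset.card_biUnion_le_card_mul _ _ _ h1, ?_, ?_⟩
  · intro C hC
    obtain ⟨z, hz, hzC⟩ := Finset.mem_biUnion.1 hC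
    exact h2 z hz C hzC
  · intro x hx
    obtain ⟨z, hz, hxz⟩ := mem_iUnion₂.1 hx
    obtain ⟨C, hC, hxC⟩ := h3 z hz hxz
    exact ⟨C, Finset.mem_coe.2 (Finset.mem_biUnion.2 ⟨z, hz, hC⟩), hxC⟩

lemma exists_mem_Ico_succ {N : ℕ} (x : Fin (N + 1) → ℝ) {z : ℝ} (h0 : x 0 ≤ z)
    (h1 : z < x (Fin.last N)) : ∃ j : Fin N, z ∈ Ico (x j.castSucc) (x j.succ) := by
  induction N with
  | zero => exact absurd (h0.trans_lt h1) (lt_irrefl _)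
  | succ N ih =>
    by_cases h : z < x (Fin.last N).castSucc
    · obtain ⟨j, hj⟩ := ih (fun i => x i.castSucc) h0 h
      exact ⟨j.castSucc, hj⟩
    · exact ⟨Fin.last N, not_lt.1 h, h1⟩

lemma exists_mem_Ioc_succ {N : ℕ} (x : Fin (N + 1) → ℝ) {z : ℝ} (h0 : x 0 < z)
    (h1 : z ≤ x (Fin.last N)) : ∃ j : Fin N, z ∈ Ioc (x j.castSucc) (x j.succ) := by
  induction N with
  | zero => exact absurd (h0.trans_le h1) (lt_irrefl _)
  | succ N ih =>
    by_cases h : z ≤ x (Fin.last N).castSucc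
    · obtain ⟨j, hj⟩ := ih (fun i => x i.castSucc) h0 h
      exact ⟨j.castSucc, hj⟩
    · exact ⟨Fin.last N, not_le.1 h, h1⟩

lemma Icc_succ_subset {a b : ℝ} {N : ℕ} {x : Fin (N + 1) → ℝ} (hx : StrictMono x) (h0 : x 0 = a)
    (h1 : x (Fin.last N) = b) (j : Fin N) : Icc (x j.castSucc) (x j.succ) ⊆ Icc a b :=
  Icc_subset_Icc (h0 ▸ hx.monotone (Fin.zero_le _)) (h1 ▸ hx.monotone (Fin.le_last _))

lemma Icc_subset_iUnion_Icc_succ {a b : ℝ} (hab : a < b) {N : ℕ} {x : Fin (N + 1) → ℝ}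
    (h0 : x 0 = a) (h1 : x (Fin.last N) = b) :
    Icc a b ⊆ ⋃ j : Fin N, Icc (x j.castSucc) (x j.succ) := by
  intro z hz
  rcases hz.1.eq_or_lt with rfl | h
  · obtain ⟨j, hj⟩ := exists_mem_Ico_succ x h0.le (h1 ▸ hab)
    exact mem_iUnion.2 ⟨j, Ico_subset_Icc_self hj⟩
  · obtain ⟨j, hj⟩ := exists_mem_Ioc_succ x (h0 ▸ h) (h1 ▸ hz.2)
    exact mem_iUnion.2 ⟨j, Ioc_subset_Icc_self hj⟩

/-- `x` is the increasing sequence of endpoints of a partition of `[a,b]` into `k` intervals on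
each of which `f` is monotone or antitone. -/
structure IsMonoPartition (a b : ℝ) (f : ℝ → ℝ) {k : ℕ} (x : Fin (k + 1) → ℝ) : Prop where
  strictMono : StrictMono x
  left : x 0 = a
  right : x (Fin.last k) = b
  mono : ∀ j : Fin k, MonoOrAntiOn f (Icc (x j.castSucc) (x j.succ))

lemma IsMonoPartition.isMonoPiece {a b : ℝ} {f : ℝ → ℝ} {k : ℕ} {x : Fin (k + 1) → ℝ}
    (h : IsMonoPartition a b f x) (j : Fin k) :
    IsMonoPiece a b f (Icc (x j.castSucc) (x j.succ)) :=
  ⟨isClosed_Icc, ordConnected_Icc, Icc_succ_subset h.strictMono h.left h.right j, h.mono j⟩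

open Classical in
lemma IsMonoPartition.monoCovered {a b : ℝ} (hab : a < b) {f : ℝ → ℝ} {k : ℕ}
    {x : Fin (k + 1) → ℝ} (h : IsMonoPartition a b f x) : MonoCovered a b f (Icc a b) k := by
  refine ⟨Finset.univ.image fun j : Fin k => Icc (x j.castSucc) (x j.succ), ?_, ?_, ?_⟩
  · exact Finset.card_image_le.trans (by simp)
  · intro C hC
    obtain ⟨j, -, rfl⟩ := Finset.mem_image.1 hC
    exact h.isMonoPiece j
  · intro z hz
    obtain ⟨j, hj⟩ := mem_iUnion.1 (Icc_subset_iUnion_Icc_succ hab h.left h.right hz)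
    exact ⟨_, Finset.mem_coe.2 (Finset.mem_image_of_mem _ (Finset.mem_univ j)), hj⟩

open Classical in
lemma exists_isMonoPartition_of_cover {f : ℝ → ℝ} {b : ℝ} (M : ℕ) :
    ∀ {a : ℝ}, a ≤ b → ∀ 𝒞 : Finset (Set ℝ), 𝒞.card ≤ M →
      (∀ C ∈ 𝒞, IsClosed C ∧ C.OrdConnected ∧ MonoOrAntiOn f C) →
      Ico a b ⊆ ⋃₀ (𝒞 : Set (Set ℝ)) →
      ∃ k ≤ M, ∃ x : Fin (k + 1) → ℝ, IsMonoPartition a b f x := by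
  have base : ∀ {a : ℝ} (M : ℕ), a = b → ∃ k ≤ M, ∃ x : Fin (k + 1) → ℝ,
      IsMonoPartition a b f x := fun {a} M h =>
    ⟨0, Nat.zero_le _, fun _ => a, fun i j hij => absurd hij (by omega), rfl, h, fun j => j.elim0⟩
  induction M with
  | zero =>
    intro a hab 𝒞 hc _ hcov
    rcases hab.eq_or_lt with h | h
    · exact base _ h
    · obtain ⟨C, hC, -⟩ := hcov ⟨le_rfl, h⟩
      rw [Finset.card_eq_zero.1 (Nat.le_zero.1 hc)] at hC
      simp at hC
  | succ M ih =>
    intro a hab 𝒞 hc h𝒞 hcov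
    rcases hab.eq_or_lt with h | h
    · exact base _ h
    obtain ⟨C, hC, haC⟩ := hcov ⟨le_rfl, h⟩
    rw [Finset.mem_coe] at hC
    obtain ⟨hCc, hCo, hCm⟩ := h𝒞 C hC
    have hcpt : IsCompact (C ∩ Icc a b) := isCompact_Icc.inter_left hCc
    obtain ⟨c, ⟨hcC, hca, hcb⟩, hcmax⟩ := hcpt.exists_isGreatest ⟨a, haC, le_rfl, hab⟩
    have hrest : Ioo c b ⊆ ⋃₀ ((𝒞.erase C : Finset (Set ℝ)) : Set (Set ℝ)) := by
      intro z hz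
      obtain ⟨D, hD, hzD⟩ := hcov ⟨hca.trans hz.1.le, hz.2⟩
      refine ⟨D, Finset.mem_coe.2 (Finset.mem_erase.2 ⟨?_, hD⟩), hzD⟩
      rintro rfl
      exact hz.1.not_ge (hcmax ⟨hzD, hca.trans hz.1.le, hz.2.le⟩)
    have hclosed : IsClosed (⋃₀ ((𝒞.erase C : Finset (Set ℝ)) : Set (Set ℝ))) :=
      sUnion_eq_biUnion ▸ (Finset.finite_toSet _).isClosed_biUnion
        fun D hD => (h𝒞 D (Finset.mem_of_mem_erase hD)).1
    have hrest' : Ico c b ⊆ ⋃₀ ((𝒞.erase C : Finset (Set ℝ)) : Set (Set ℝ)) := by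
      rcases hcb.eq_or_lt with h' | h'
      · simp [h']
      · refine Ico_subset_Icc_self.trans ?_
        rw [← closure_Ioo h'.ne]
        exact closure_minimal hrest hclosed
    obtain ⟨k, hk, x, hx⟩ := ih hcb (𝒞.erase C)
      (by rw [Finset.card_erase_of_mem hC]; omega)
      (fun D hD => h𝒞 D (Finset.mem_of_mem_erase hD)) hrest'
    rcases hca.eq_or_lt with rfl | hac
    · exact ⟨k, hk.trans (Nat.le_succ _), x, hx⟩
    · refine ⟨k + 1, Nat.succ_le_succ hk, Fin.cons a x, ?_, rfl, ?_, ?_⟩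
      · rw [Fin.strictMono_iff_lt_succ]
        intro i
        refine Fin.cases ?_ (fun i => ?_) i
        · simpa [hx.left] using hac
        · simpa [Fin.castSucc_succ] using hx.strictMono (Fin.castSucc_lt_succ (i := i))
      · rw [← Fin.succ_last, Fin.cons_succ]
        exact hx.right
      · intro j
        refine Fin.cases ?_ (fun j => ?_) j
        · simp only [Fin.castSucc_zero, Fin.cons_zero, Fin.cons_succ, hx.left]
          exact hCm.mono (hCo.out haC hcC)
        · simpa [Fin.castSucc_succ] using hx.mono j

lemma lapNum_eq_sInf (a b : ℝ) (f : ℝ → ℝ) :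
    lapNum a b f = sInf {k : ℕ | ∃ x : Fin (k + 1) → ℝ, IsMonoPartition a b f x} := by
  unfold lapNum
  congr 1
  ext k
  exact exists_congr fun x => ⟨fun ⟨h1, h2, h3, h4⟩ => ⟨h1, h2, h3, h4⟩,
    fun ⟨h1, h2, h3, h4⟩ => ⟨h1, h2, h3, h4⟩⟩

lemma MonoCovered.exists_isMonoPartition {a b : ℝ} (hab : a < b) {f : ℝ → ℝ} {M : ℕ}
    (h : MonoCovered a b f (Icc a b) M) :
    ∃ k ≤ M, ∃ x : Fin (k + 1) → ℝ, IsMonoPartition a b f x := by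
  obtain ⟨𝒞, h1, h2, h3⟩ := h
  exact exists_isMonoPartition_of_cover M hab.le 𝒞 h1
    (fun C hC => ⟨(h2 C hC).isClosed, (h2 C hC).ordConnected, (h2 C hC).mono⟩)
    (Ico_subset_Icc_self.trans h3)

lemma MonoCovered.lapNum_le {a b : ℝ} (hab : a < b) {f : ℝ → ℝ} {M : ℕ}
    (h : MonoCovered a b f (Icc a b) M) : lapNum a b f ≤ M := by
  obtain ⟨k, hk, hx⟩ := h.exists_isMonoPartition hab
  rw [lapNum_eq_sInf]
  exact (Nat.sInf_le hx).trans hk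

lemma MonoCovered.exists_lapNum {a b : ℝ} (hab : a < b) {f : ℝ → ℝ} {M : ℕ}
    (h : MonoCovered a b f (Icc a b) M) :
    ∃ x : Fin (lapNum a b f + 1) → ℝ, IsMonoPartition a b f x := by
  obtain ⟨k, -, hx⟩ := h.exists_isMonoPartition hab
  rw [lapNum_eq_sInf]
  exact Nat.sInf_mem (s := {k : ℕ | ∃ x : Fin (k + 1) → ℝ, IsMonoPartition a b f x}) ⟨k, hx⟩

lemma IsMonoPartition.pos {a b : ℝ} (hab : a < b) {f : ℝ → ℝ} {k : ℕ} {x : Fin (k + 1) → ℝ}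
    (h : IsMonoPartition a b f x) : 0 < k := by
  rcases Nat.eq_zero_or_pos k with rfl | hk
  · exact absurd (h.left.symm.trans h.right) hab.ne
  · exact hk

lemma IsMonoPartition.exists_piece_right {a b : ℝ} {f : ℝ → ℝ} {k : ℕ} {x : Fin (k + 1) → ℝ}
    (h : IsMonoPartition a b f x) {z : ℝ} (hz : z ∈ Icc a b) :
    ∃ d > z, ∃ D, IsMonoPiece a b f D ∧ ∀ y ∈ Icc a b, z ≤ y → y < d → y ∈ D := by
  rcases hz.2.eq_or_lt with rfl | hzb
  · refine ⟨z + 1, by simp, {z}, ⟨isClosed_singleton, ordConnected_singleton, by simpa using hz,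
      Or.inl (by simp)⟩, fun y hy hzy _ => le_antisymm hy.2 hzy⟩
  · obtain ⟨j, hj⟩ := exists_mem_Ico_succ x (h.left ▸ hz.1) (h.right ▸ hzb)
    exact ⟨_, hj.2, _, h.isMonoPiece j, fun y _ h1 h2 => ⟨hj.1.trans h1, h2.le⟩⟩

lemma IsMonoPartition.exists_piece_left {a b : ℝ} {f : ℝ → ℝ} {k : ℕ} {x : Fin (k + 1) → ℝ}
    (h : IsMonoPartition a b f x) {z : ℝ} (hz : z ∈ Icc a b) :
    ∃ c < z, ∃ D, IsMonoPiece a b f D ∧ ∀ y ∈ Icc a b, y ≤ z → c < y → y ∈ D := by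
  rcases hz.1.eq_or_lt with rfl | haz
  · refine ⟨a - 1, by simp, {a}, ⟨isClosed_singleton, ordConnected_singleton, by simpa using hz,
      Or.inl (by simp)⟩, fun y hy hzy _ => le_antisymm hzy hy.1⟩
  · obtain ⟨j, hj⟩ := exists_mem_Ioc_succ x (h.left ▸ haz) (h.right ▸ hz.2)
    exact ⟨_, hj.1, _, h.isMonoPiece j, fun y _ h1 h2 => ⟨h2.le, h1.trans hj.2⟩⟩

open Classical in
/-- Small balls meet at most two monotone pieces. -/
lemma IsMonoPartition.exists_ball_monoCovered {a b : ℝ} {f : ℝ → ℝ} {k : ℕ}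
    {x : Fin (k + 1) → ℝ} (h : IsMonoPartition a b f x) :
    ∃ ε > 0, ∀ z ∈ Icc a b, MonoCovered a b f (Icc a b ∩ Metric.ball z ε) 2 := by
  have hloc : ∀ z : Icc a b, ∃ U, IsOpen U ∧ z.1 ∈ U ∧ MonoCovered a b f (Icc a b ∩ U) 2 := by
    rintro ⟨z, hz⟩
    obtain ⟨d, hd, D, hD, hD'⟩ := h.exists_piece_right hz
    obtain ⟨c, hc, C, hC, hC'⟩ := h.exists_piece_left hz
    refine ⟨Ioo c d, isOpen_Ioo, ⟨hc, hd⟩, {C, D}, Finset.card_le_two, by simp [hC, hD], ?_⟩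
    rintro y ⟨hy, hcy, hyd⟩
    rcases le_total y z with hyz | hyz
    · exact ⟨C, by simp, hC' y hy hyz hcy⟩
    · exact ⟨D, by simp, hD' y hy hyz hyd⟩
  choose U hUo hUz hU using hloc
  obtain ⟨ε, hε, hball⟩ := lebesgue_number_lemma_of_metric (isCompact_Icc (a := a) (b := b)) hUo
    fun z hz => mem_iUnion.2 ⟨⟨z, hz⟩, hUz ⟨z, hz⟩⟩
  refine ⟨ε, hε, fun z hz => ?_⟩
  obtain ⟨w, hw⟩ := hball z hz
  exact (hU w).subset (inter_subset_inter_right _ hw)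

lemma monoCovered_id (a b : ℝ) : MonoCovered a b id (Icc a b) 1 :=
  ⟨{Icc a b}, by simp, by
    simpa using ⟨isClosed_Icc, ordConnected_Icc, Subset.rfl, Or.inl monotoneOn_id⟩, by simp⟩

lemma monoCovered_bowenBall {a b : ℝ} {f : ℝ → ℝ} (hf : ContinuousOn f (Icc a b))
    (hmap : MapsTo f (Icc a b) (Icc a b)) {ε : ℝ} {M : ℕ}
    (hloc : ∀ z ∈ Icc a b, MonoCovered a b f (Icc a b ∩ Metric.ball z ε) M) (n : ℕ) {z : ℝ}
    (hz : z ∈ Icc a b) :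
    MonoCovered a b f^[n] {y | y ∈ Icc a b ∧ ∀ i < n, |f^[i] z - f^[i] y| < ε} (M ^ n) := by
  induction n with
  | zero => exact (monoCovered_id a b).subset fun y hy => hy.1
  | succ n ih =>
    rw [Function.iterate_succ', pow_succ]
    refine (ih.comp (hloc _ (hmap.iterate n hz)) (hf.iterate hmap n)).subset ?_
    rintro y ⟨hy, hi⟩
    refine ⟨⟨hy, fun i hin => hi i (hin.trans n.lt_succ_self)⟩, hmap.iterate n hy, ?_⟩
    rw [Metric.mem_ball', Real.dist_eq]
    exact hi n n.lt_succ_self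

/-- Distinct points of `S` have `ε`-separated orbits of length `n`. -/
def IsBowenSeparated (T : ℝ → ℝ) (n : ℕ) (ε : ℝ) (S : Finset ℝ) : Prop :=
  ∀ x ∈ S, ∀ y ∈ S, x ≠ y → ∃ i < n, ε ≤ |T^[i] x - T^[i] y|

lemma sepNum_eq_sSup (T : ℝ → ℝ) (K : Set ℝ) (n : ℕ) (ε : ℝ) :
    sepNum T K n ε =
      sSup {k : ℕ | ∃ S : Finset ℝ, ↑S ⊆ K ∧ S.card = k ∧ IsBowenSeparated T n ε S} := rfl

lemma sepNum_le {T : ℝ → ℝ} {K : Set ℝ} {n : ℕ} {ε : ℝ} {B : ℕ}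
    (hB : ∀ S : Finset ℝ, ↑S ⊆ K → IsBowenSeparated T n ε S → S.card ≤ B) :
    sepNum T K n ε ≤ B := by
  rw [sepNum_eq_sSup]
  refine csSup_le ⟨0, ∅, by simp, rfl, by simp [IsBowenSeparated]⟩ ?_
  rintro k ⟨S, hS, rfl, hsep⟩
  exact hB S hS hsep

lemma IsBowenSeparated.card_le_sepNum {T : ℝ → ℝ} {K : Set ℝ} {n : ℕ} {ε : ℝ} {B : ℕ}
    (hB : ∀ S : Finset ℝ, ↑S ⊆ K → IsBowenSeparated T n ε S → S.card ≤ B)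
    {S : Finset ℝ} (hS : ↑S ⊆ K) (hsep : IsBowenSeparated T n ε S) :
    S.card ≤ sepNum T K n ε := by
  rw [sepNum_eq_sSup]
  refine le_csSup ⟨B, ?_⟩ ⟨S, hS, rfl, hsep⟩
  rintro k ⟨S, hS, rfl, hsep⟩
  exact hB S hS hsep

lemma exists_card_eq_sepNum {T : ℝ → ℝ} {K : Set ℝ} {n : ℕ} {ε : ℝ} {B : ℕ}
    (hB : ∀ S : Finset ℝ, ↑S ⊆ K → IsBowenSeparated T n ε S → S.card ≤ B) :
    ∃ S : Finset ℝ, ↑S ⊆ K ∧ S.card = sepNum T K n ε ∧ IsBowenSeparated T n ε S := by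
  rw [sepNum_eq_sSup]
  refine Nat.sSup_mem (s := {k : ℕ | ∃ S : Finset ℝ, ↑S ⊆ K ∧ S.card = k ∧
    IsBowenSeparated T n ε S}) ⟨0, ∅, by simp, rfl, by simp [IsBowenSeparated]⟩ ⟨B, ?_⟩
  rintro k ⟨S, hS, rfl, hsep⟩
  exact hB S hS hsep

/-- A maximal separated set is spanning, which bounds the lap number of an iterate. -/
lemma lapNum_iterate_le_sepNum_mul {a b : ℝ} (hab : a < b) {f : ℝ → ℝ}
    (hf : ContinuousOn f (Icc a b)) (hmap : MapsTo f (Icc a b) (Icc a b)) {ε : ℝ} (hε : 0 < ε)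
    {M : ℕ} (hloc : ∀ z ∈ Icc a b, MonoCovered a b f (Icc a b ∩ Metric.ball z ε) M) (n : ℕ)
    {B : ℕ} (hB : ∀ S : Finset ℝ, ↑S ⊆ Icc a b → IsBowenSeparated f n ε S → S.card ≤ B) :
    lapNum a b f^[n] ≤ sepNum f (Icc a b) n ε * M ^ n := by
  obtain ⟨S, hS, hcard, hsep⟩ := exists_card_eq_sepNum hB
  rw [← hcard]
  refine ((MonoCovered.biUnion fun z hz =>
    monoCovered_bowenBall hf hmap hloc n (hS hz)).subset fun y hy => ?_).lapNum_le hab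
  by_contra hcon
  simp only [mem_iUnion, mem_ofPred_eq, not_exists, not_and, not_forall, not_lt] at hcon
  have hyS : y ∉ S := fun hyS => by
    obtain ⟨i, -, hi⟩ := hcon y hyS hy
    simp at hi
    exact hi.not_gt hε
  have hsep' : IsBowenSeparated f n ε (insert y S) := by
    intro u hu v hv huv
    rcases Finset.mem_insert.1 hu with rfl | hu'
    · rcases Finset.mem_insert.1 hv with rfl | hv
      · exact absurd rfl huv
      · obtain ⟨i, hi, h⟩ := hcon v hv hy
        exact ⟨i, hi, abs_sub_comm (f^[i] u) _ ▸ h⟩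
    · rcases Finset.mem_insert.1 hv with h' | hv
      · subst h'
        obtain ⟨i, hi, h⟩ := hcon u hu' hy
        exact ⟨i, hi, h⟩
      · exact hsep u hu' v hv huv
  have hle := hsep'.card_le_sepNum hB (K := Icc a b) (by
    rw [Finset.coe_insert]
    exact insert_subset hy hS)
  rw [Finset.card_insert_of_notMem hyS] at hle
  omega

lemma card_le_of_le_abs_sub {S : Finset ℝ} {F : ℝ → ℝ} {c W ε : ℝ} (hε : 0 < ε)
    (hF : ∀ x ∈ S, F x ∈ Icc c (c + W))
    (hsep : ∀ x ∈ S, ∀ y ∈ S, x ≠ y → ε ≤ |F x - F y|) : S.card ≤ ⌊W / ε⌋₊ + 1 := by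
  rw [← Finset.card_range (⌊W / ε⌋₊ + 1)]
  have hnn : ∀ x ∈ S, 0 ≤ (F x - c) / ε := fun x hx =>
    div_nonneg (sub_nonneg.2 (hF x hx).1) hε.le
  refine Finset.card_le_card_of_injOn (fun x => ⌊(F x - c) / ε⌋₊) (fun x hx => ?_) ?_
  · simp only [Finset.coe_range, mem_Iio, Nat.lt_succ_iff]
    exact Nat.floor_mono (div_le_div_of_nonneg_right (by linarith [(hF x hx).2]) hε.le)
  · intro x hx y hy hxy
    by_contra hne
    simp only at hxy
    have h1 := Nat.floor_le (hnn x hx)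
    have h2 := Nat.floor_le (hnn y hy)
    have h3 := Nat.lt_floor_add_one ((F x - c) / ε)
    have h4 := Nat.lt_floor_add_one ((F y - c) / ε)
    rw [hxy] at h1 h3
    have h5 : |(F x - c) / ε - (F y - c) / ε| < 1 := abs_lt.2 ⟨by linarith, by linarith⟩
    rw [← sub_div, sub_sub_sub_cancel_right, abs_div, abs_of_pos hε, div_lt_one hε] at h5
    exact h5.not_ge (hsep x hx y hy hne)

open Classical in
lemma IsBowenSeparated.card_le_of_mono {a b : ℝ} {T : ℝ → ℝ} {n : ℕ} {ε : ℝ} (hε : 0 < ε)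
    {S : Finset ℝ} (hsep : IsBowenSeparated T n ε S)
    (hmono : ∀ i < n, MonoOrAntiOn T^[i] (S : Set ℝ))
    (hmem : ∀ i < n, ∀ x ∈ S, T^[i] x ∈ Icc a b) :
    S.card ≤ ⌊n * (b - a) / ε⌋₊ + 1 := by
  set g : ℕ → ℝ → ℝ := fun i x =>
    if MonotoneOn T^[i] (S : Set ℝ) then T^[i] x - a else b - T^[i] x with hg
  have hgmem : ∀ i < n, ∀ x ∈ S, g i x ∈ Icc 0 (b - a) := by
    intro i hi x hx
    have := hmem i hi x hx
    by_cases h : MonotoneOn T^[i] (S : Set ℝ)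
    · simp only [hg, h, if_true]
      exact ⟨by linarith [this.1], by linarith [this.2]⟩
    · simp only [hg, h, if_false]
      exact ⟨by linarith [this.2], by linarith [this.1]⟩
  have hgsub : ∀ i < n, ∀ x ∈ S, ∀ y ∈ S, x ≤ y → g i y - g i x = |T^[i] x - T^[i] y| := by
    intro i hi x hx y hy hxy
    by_cases h : MonotoneOn T^[i] (S : Set ℝ)
    · simp only [hg, h, if_true]
      rw [abs_of_nonpos (sub_nonpos.2 (h hx hy hxy))]
      ring
    · simp only [hg, h, if_false]
      rw [abs_of_nonneg (sub_nonneg.2 (((hmono i hi).resolve_left h) hx hy hxy))]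
      ring
  have hlt : ∀ x ∈ S, ∀ y ∈ S, x < y →
      ε ≤ (∑ i ∈ Finset.range n, g i y) - ∑ i ∈ Finset.range n, g i x := by
    intro x hx y hy hxy
    obtain ⟨i, hi, h⟩ := hsep x hx y hy hxy.ne
    rw [← Finset.sum_sub_distrib]
    refine (h.trans (hgsub i hi x hx y hy hxy.le).ge).trans
      (Finset.single_le_sum (f := fun i => g i y - g i x) (fun j hj => ?_)
        (Finset.mem_range.2 hi))
    rw [hgsub j (Finset.mem_range.1 hj) x hx y hy hxy.le]
    exact abs_nonneg _
  refine card_le_of_le_abs_sub (F := fun x => ∑ i ∈ Finset.range n, g i x) (c := 0) hε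
    (fun x hx => ⟨?_, ?_⟩) fun x hx y hy hne => ?_
  · exact Finset.sum_nonneg fun i hi => (hgmem i (Finset.mem_range.1 hi) x hx).1
  · rw [zero_add]
    refine (Finset.sum_le_card_nsmul _ _ (b - a)
      fun i hi => (hgmem i (Finset.mem_range.1 hi) x hx).2).trans ?_
    simp
  · rcases hne.lt_or_gt with h | h
    · rw [abs_sub_comm]
      exact (hlt x hx y hy h).trans (le_abs_self _)
    · exact (hlt y hy x hx h).trans (le_abs_self _)

lemma MonoOrAntiOn.injOn {f : ℝ → ℝ} {s : Set ℝ} (h : MonoOrAntiOn f s) (hs : s.OrdConnected)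
    (hfin : ∀ c, (s ∩ f ⁻¹' {c}).Finite) : InjOn f s := by
  have key : ∀ x ∈ s, ∀ y ∈ s, x < y → f x ≠ f y := by
    intro x hx y hy hxy hf
    refine (Icc_infinite hxy) ((hfin (f x)).subset fun z hz => ?_)
    have hzs := hs.out hx hy hz
    refine ⟨hzs, ?_⟩
    rcases h with h | h
    · exact le_antisymm (hf ▸ h hzs hy hz.2) (h hx hzs hz.1)
    · exact le_antisymm (h hx hzs hz.1) (hf ▸ h hzs hy hz.2)
  intro x hx y hy hf
  by_contra hne
  rcases lt_or_gt_of_ne hne with h' | h'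
  · exact key x hx y hy h' hf
  · exact key y hy x hx h' hf.symm

lemma finite_fiber_iterate {T : ℝ → ℝ} {s : Set ℝ} (hmap : MapsTo T s s)
    (hfin : ∀ c, (s ∩ T ⁻¹' {c}).Finite) (n : ℕ) (c : ℝ) : (s ∩ T^[n] ⁻¹' {c}).Finite := by
  induction n generalizing c with
  | zero => exact (finite_singleton c).subset fun x hx => hx.2
  | succ n ih =>
    refine ((ih c).biUnion fun d _ => hfin d).subset fun x hx => ?_
    exact mem_iUnion₂.2 ⟨T x, ⟨hmap hx.1, hx.2⟩, hx.1, rfl⟩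

/-- If an iterate `T^n` of a finite-to-one map is monotone on an interval, then all `T^i`, `i ≤ n`,
are injective there. -/
lemma injOn_iterate_of_mono {T : ℝ → ℝ} {s t : Set ℝ} (hmap : MapsTo T s s)
    (hfin : ∀ c, (s ∩ T ⁻¹' {c}).Finite) {n : ℕ} (hts : t ⊆ s) (ht : t.OrdConnected)
    (h : MonoOrAntiOn T^[n] t) {i : ℕ} (hi : i ≤ n) : InjOn T^[i] t := by
  have hinj := h.injOn ht fun c =>
    (finite_fiber_iterate hmap hfin n c).subset (inter_subset_inter_left _ hts)
  intro x hx y hy hxy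
  refine hinj hx hy ?_
  rw [← Nat.sub_add_cancel hi, Function.iterate_add_apply, Function.iterate_add_apply, hxy]

lemma Set.InjOn.monoOrAntiOn {f : ℝ → ℝ} {u v : ℝ} (huv : u ≤ v) (hinj : InjOn f (Icc u v))
    (hf : ContinuousOn f (Icc u v)) : MonoOrAntiOn f (Icc u v) :=
  (hf.strictMonoOn_of_injOn_Icc' huv hinj).imp StrictMonoOn.monotoneOn StrictAntiOn.antitoneOn

lemma IsBowenSeparated.card_le {a b : ℝ} (hab : a < b) {T : ℝ → ℝ}
    (hT : ContinuousOn T (Icc a b)) (hmap : MapsTo T (Icc a b) (Icc a b))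
    (hfin : ∀ c, (Icc a b ∩ T ⁻¹' {c}).Finite) {n : ℕ} {ε : ℝ} (hε : 0 < ε) {k : ℕ}
    {x : Fin (k + 1) → ℝ} (hx : IsMonoPartition a b T^[n] x) {S : Finset ℝ}
    (hS : ↑S ⊆ Icc a b) (hsep : IsBowenSeparated T n ε S) :
    S.card ≤ k * (⌊n * (b - a) / ε⌋₊ + 1) := by
  have hcov : S ⊆ Finset.univ.biUnion
      fun j : Fin k => S.filter (· ∈ Icc (x j.castSucc) (x j.succ)) := by
    intro z hz
    obtain ⟨j, hj⟩ := mem_iUnion.1 (Icc_subset_iUnion_Icc_succ hab hx.left hx.right (hS hz))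
    exact Finset.mem_biUnion.2 ⟨j, Finset.mem_univ j, Finset.mem_filter.2 ⟨hz, hj⟩⟩
  refine (Finset.card_le_card hcov).trans ((Finset.card_biUnion_le_card_mul _ _
    (⌊n * (b - a) / ε⌋₊ + 1) fun j _ => ?_).trans (by simp))
  have hsub := (hx.isMonoPiece j).subset
  refine IsBowenSeparated.card_le_of_mono hε (T := T) (a := a) (b := b)
    (fun y hy z hz => hsep y (Finset.mem_filter.1 hy).1 z (Finset.mem_filter.1 hz).1)
    (fun i hi => ?_) (fun i _ y hy => hmap.iterate i (hS (Finset.mem_filter.1 hy).1))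
  exact (InjOn.monoOrAntiOn (hx.strictMono (Fin.castSucc_lt_succ)).le
    (injOn_iterate_of_mono hmap hfin hsub ordConnected_Icc (hx.mono j) hi.le)
    ((hT.iterate hmap i).mono hsub)).mono fun y hy => (Finset.mem_filter.1 hy).2

/-- A continuous finite-to-one self-map of `[a,b]` with finitely many monotone pieces. -/
structure IsPiecewiseMonoMap (a b : ℝ) (T : ℝ → ℝ) : Prop where
  lt : a < b
  continuousOn : ContinuousOn T (Icc a b)
  mapsTo : MapsTo T (Icc a b) (Icc a b)
  finite_fiber : ∀ c, (Icc a b ∩ T ⁻¹' {c}).Finite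
  covered : ∃ M, MonoCovered a b T (Icc a b) M

namespace IsPiecewiseMonoMap

variable {a b : ℝ} {T : ℝ → ℝ}

lemma of_strict {N : ℕ} (hab : a < b) (hmap : MapsTo T (Icc a b) (Icc a b))
    {x : Fin (N + 1) → ℝ} (hx : StrictMono x) (h0 : x 0 = a) (h1 : x (Fin.last N) = b)
    (h : ∀ j : Fin N, ContinuousOn T (Icc (x j.castSucc) (x j.succ)) ∧
        (StrictMonoOn T (Icc (x j.castSucc) (x j.succ)) ∨
          StrictAntiOn T (Icc (x j.castSucc) (x j.succ)))) : IsPiecewiseMonoMap a b T where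
  lt := hab
  continuousOn := ((locallyFinite_of_finite _).continuousOn_iUnion (fun _ => isClosed_Icc)
    fun j => (h j).1).mono (Icc_subset_iUnion_Icc_succ hab h0 h1)
  mapsTo := hmap
  finite_fiber c := by
    have hfin : (⋃ j : Fin N, Icc (x j.castSucc) (x j.succ) ∩ T ⁻¹' {c}).Finite := by
      refine finite_iUnion fun j => Set.Subsingleton.finite ?_
      rintro y ⟨hy, hyc⟩ z ⟨hz, hzc⟩
      exact ((h j).2.elim StrictMonoOn.injOn StrictAntiOn.injOn) hy hz (hyc.trans hzc.symm)
    rw [← iUnion_inter] at hfin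
    exact hfin.subset (inter_subset_inter_left _ (Icc_subset_iUnion_Icc_succ hab h0 h1))
  covered := ⟨N, IsMonoPartition.monoCovered hab (x := x)
    ⟨hx, h0, h1, fun j => (h j).2.imp StrictMonoOn.monotoneOn StrictAntiOn.antitoneOn⟩⟩

lemma iterate (h : IsPiecewiseMonoMap a b T) (n : ℕ) : IsPiecewiseMonoMap a b T^[n] where
  lt := h.lt
  continuousOn := h.continuousOn.iterate h.mapsTo n
  mapsTo := h.mapsTo.iterate n
  finite_fiber := finite_fiber_iterate h.mapsTo h.finite_fiber n
  covered := by
    induction n with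
    | zero => exact ⟨1, monoCovered_id a b⟩
    | succ n ih =>
      obtain ⟨M, hM⟩ := ih
      obtain ⟨L, hL⟩ := h.covered
      rw [Function.iterate_succ']
      exact ⟨M * L, (hM.comp hL (h.continuousOn.iterate h.mapsTo n)).subset
        fun x hx => ⟨hx, h.mapsTo.iterate n hx⟩⟩

lemma exists_lapNum (h : IsPiecewiseMonoMap a b T) :
    ∃ x : Fin (lapNum a b T + 1) → ℝ, IsMonoPartition a b T x :=
  let ⟨_, hM⟩ := h.covered
  hM.exists_lapNum h.lt

lemma lapNum_pos (h : IsPiecewiseMonoMap a b T) : 0 < lapNum a b T :=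
  let ⟨_, hx⟩ := h.exists_lapNum
  hx.pos h.lt

lemma lapNum_iterate_add_le (h : IsPiecewiseMonoMap a b T) (m n : ℕ) :
    lapNum a b T^[m + n] ≤ lapNum a b T^[m] * lapNum a b T^[n] := by
  obtain ⟨x, hx⟩ := (h.iterate m).exists_lapNum
  obtain ⟨y, hy⟩ := (h.iterate n).exists_lapNum
  rw [Nat.add_comm, Function.iterate_add]
  exact (((hx.monoCovered h.lt).comp (hy.monoCovered h.lt) (h.iterate m).continuousOn).subset
    fun x hx => ⟨hx, h.mapsTo.iterate m hx⟩).lapNum_le h.lt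

lemma exists_tendsto_log_lapNum (h : IsPiecewiseMonoMap a b T) :
    ∃ L, Tendsto (fun n : ℕ => (n : ℝ)⁻¹ * Real.log (lapNum a b T^[n])) atTop (nhds L) := by
  have hsub : Subadditive fun n : ℕ => Real.log (lapNum a b T^[n]) := by
    intro m n
    have hm := (h.iterate m).lapNum_pos
    have hn := (h.iterate n).lapNum_pos
    have hmn := (h.iterate (m + n)).lapNum_pos
    rw [← Real.log_mul (by positivity) (by positivity)]
    exact Real.log_le_log (by exact_mod_cast hmn) (by exact_mod_cast h.lapNum_iterate_add_le m n)
  refine ⟨hsub.lim, ?_⟩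
  simp only [inv_mul_eq_div]
  refine hsub.tendsto_lim ⟨0, ?_⟩
  rintro _ ⟨n, rfl⟩
  exact div_nonneg (Real.log_natCast_nonneg _) (Nat.cast_nonneg _)

lemma card_le (h : IsPiecewiseMonoMap a b T) {n : ℕ} {ε : ℝ} (hε : 0 < ε) (S : Finset ℝ)
    (hS : ↑S ⊆ Icc a b) (hsep : IsBowenSeparated T n ε S) :
    S.card ≤ lapNum a b T^[n] * (⌊n * (b - a) / ε⌋₊ + 1) :=
  let ⟨_, hx⟩ := (h.iterate n).exists_lapNum
  hsep.card_le h.lt h.continuousOn h.mapsTo h.finite_fiber hε hx hS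

lemma sepNum_pos (h : IsPiecewiseMonoMap a b T) {n : ℕ} {ε : ℝ} (hε : 0 < ε) :
    0 < sepNum T (Icc a b) n ε := by
  have hsep : IsBowenSeparated T n ε {a} := by
    intro x hx y hy hxy
    rw [Finset.mem_singleton] at hx hy
    exact absurd (hx.trans hy.symm) hxy
  have := hsep.card_le_sepNum (h.card_le hε) (by simpa using h.lt.le)
  rwa [Finset.card_singleton] at this

lemma sepNum_iterate_le (h : IsPiecewiseMonoMap a b T) {k n : ℕ} (hk : 0 < k) {ε : ℝ}
    (hε : 0 < ε) : sepNum T^[k] (Icc a b) n ε ≤ sepNum T (Icc a b) (k * n) ε := by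
  refine sepNum_le fun S hS hsep => IsBowenSeparated.card_le_sepNum (h.card_le hε) hS ?_
  intro x hx y hy hxy
  obtain ⟨i, hi, hle⟩ := hsep x hx y hy hxy
  refine ⟨k * i, Nat.mul_lt_mul_of_pos_left hi hk, ?_⟩
  rwa [Function.iterate_mul]

lemma exists_lapNum_le_sepNum_mul (h : IsPiecewiseMonoMap a b T) {k : ℕ} (hk : 0 < k) :
    ∃ ε > 0, ∀ n, lapNum a b T^[k * n] ≤ sepNum T (Icc a b) (k * n) ε * 2 ^ n := by
  obtain ⟨x, hx⟩ := (h.iterate k).exists_lapNum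
  obtain ⟨ε, hε, hloc⟩ := hx.exists_ball_monoCovered
  refine ⟨ε, hε, fun n => ?_⟩
  rw [Function.iterate_mul]
  exact (lapNum_iterate_le_sepNum_mul h.lt (h.iterate k).continuousOn (h.iterate k).mapsTo hε hloc
    n ((h.iterate k).card_le hε)).trans (Nat.mul_le_mul_right _ (h.sepNum_iterate_le hk hε))

end IsPiecewiseMonoMap

lemma inv_mul_log_natCast_nonneg (n m : ℕ) : 0 ≤ (n : ℝ)⁻¹ * Real.log m :=
  mul_nonneg (inv_nonneg.2 (Nat.cast_nonneg _)) (Real.log_natCast_nonneg _)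

lemma tendsto_inv_mul_log_mul_add_one {C : ℝ} (hC : 0 < C) :
    Tendsto (fun n : ℕ => (n : ℝ)⁻¹ * Real.log (n * C + 1)) atTop (nhds 0) := by
  have h1 : Tendsto (fun n : ℕ => (n : ℝ) * C + 1) atTop atTop :=
    tendsto_atTop_add_const_right _ _ (tendsto_natCast_atTop_atTop.atTop_mul_const hC)
  refine ((Real.tendsto_pow_log_div_mul_add_atTop C⁻¹ (-C⁻¹) 1 (inv_ne_zero hC.ne')).comp
    h1).congr fun n => ?_
  have : C⁻¹ * (n * C + 1) + -C⁻¹ = n := by field_simp; ring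
  rw [Function.comp_apply, this, pow_one, inv_mul_eq_div]

lemma limsup_inv_mul_log_le {u : ℕ → ℕ} {w : ℕ → ℝ} {L : ℝ}
    (h : ∀ᶠ n : ℕ in atTop, (n : ℝ)⁻¹ * Real.log (u n) ≤ w n) (hw : Tendsto w atTop (nhds L)) :
    limsup (fun n : ℕ => (n : ℝ)⁻¹ * Real.log (u n)) atTop ≤ L := by
  rw [← hw.limsup_eq]
  exact limsup_le_limsup h
    (isCoboundedUnder_le_of_le _ fun n => inv_mul_log_natCast_nonneg n (u n)) hw.isBoundedUnder_le

namespace IsPiecewiseMonoMap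

variable {a b : ℝ} {T : ℝ → ℝ} {L : ℝ}

lemma inv_mul_log_sepNum_le (h : IsPiecewiseMonoMap a b T) {ε : ℝ} (hε : 0 < ε) (n : ℕ) :
    (n : ℝ)⁻¹ * Real.log (sepNum T (Icc a b) n ε) ≤ (n : ℝ)⁻¹ * Real.log (lapNum a b T^[n]) +
      (n : ℝ)⁻¹ * Real.log (n * ((b - a) / ε) + 1) := by
  have hpos : 0 ≤ n * ((b - a) / ε) :=
    mul_nonneg n.cast_nonneg (div_nonneg (sub_nonneg.2 h.lt.le) hε.le)
  have hlap := (h.iterate n).lapNum_pos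
  rw [← mul_add, ← Real.log_mul (by positivity) (by positivity)]
  refine mul_le_mul_of_nonneg_left (Real.log_le_log (by exact_mod_cast h.sepNum_pos hε) ?_)
    (inv_nonneg.2 n.cast_nonneg)
  have h1 : (sepNum T (Icc a b) n ε : ℝ) ≤
      lapNum a b T^[n] * ((⌊n * (b - a) / ε⌋₊ : ℝ) + 1) := by
    exact_mod_cast sepNum_le (h.card_le hε)
  refine h1.trans (mul_le_mul_of_nonneg_left ?_ (Nat.cast_nonneg _))
  rw [← mul_div_assoc] at hpos ⊢
  linarith [Nat.floor_le hpos]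

lemma tendsto_upper (h : IsPiecewiseMonoMap a b T) {ε : ℝ} (hε : 0 < ε)
    (hL : Tendsto (fun n : ℕ => (n : ℝ)⁻¹ * Real.log (lapNum a b T^[n])) atTop (nhds L)) :
    Tendsto (fun n : ℕ => (n : ℝ)⁻¹ * Real.log (lapNum a b T^[n]) +
      (n : ℝ)⁻¹ * Real.log (n * ((b - a) / ε) + 1)) atTop (nhds L) := by
  simpa using hL.add (tendsto_inv_mul_log_mul_add_one (div_pos (sub_pos.2 h.lt) hε))

lemma limsup_sepNum_le (h : IsPiecewiseMonoMap a b T) {ε : ℝ} (hε : 0 < ε)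
    (hL : Tendsto (fun n : ℕ => (n : ℝ)⁻¹ * Real.log (lapNum a b T^[n])) atTop (nhds L)) :
    limsup (fun n : ℕ => (n : ℝ)⁻¹ * Real.log (sepNum T (Icc a b) n ε)) atTop ≤ L :=
  limsup_inv_mul_log_le (Eventually.of_forall (h.inv_mul_log_sepNum_le hε))
    (h.tendsto_upper hε hL)

lemma sub_log_two_div_le_htop (h : IsPiecewiseMonoMap a b T)
    (hL : Tendsto (fun n : ℕ => (n : ℝ)⁻¹ * Real.log (lapNum a b T^[n])) atTop (nhds L))
    {k : ℕ} (hk : 0 < k) : L - Real.log 2 / k ≤ htop T (Icc a b) := by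
  obtain ⟨ε, hε, hle⟩ := h.exists_lapNum_le_sepNum_mul hk
  have hbdd : BddAbove (range fun ε : {ε : ℝ // 0 < ε} =>
      limsup (fun n : ℕ => (n : ℝ)⁻¹ * Real.log (sepNum T (Icc a b) n ε)) atTop) := by
    refine ⟨L, ?_⟩
    rintro _ ⟨ε, rfl⟩
    exact h.limsup_sepNum_le ε.2 hL
  refine le_trans ?_ (le_ciSup hbdd ⟨ε, hε⟩)
  have hmul : Tendsto (fun n : ℕ => k * n) atTop atTop :=
    tendsto_id.const_mul_atTop' hk
  refine le_of_forall_lt fun c hc => ?_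
  obtain ⟨c', hcc', hc'⟩ := exists_between hc
  refine hcc'.trans_le (le_limsup_of_frequently_le ?_ ?_)
  · have hev := (hL.comp hmul).eventually (eventually_gt_nhds (lt_sub_iff_add_lt.1 hc'))
    refine hmul.frequently ((hev.and (eventually_gt_atTop 0)).mono ?_).frequently
    rintro n ⟨hn, hn0⟩
    simp only [Function.comp_apply] at hn
    have hs := h.sepNum_pos (n := k * n) hε
    have hl := (h.iterate (k * n)).lapNum_pos
    have hlog : Real.log (lapNum a b T^[k * n]) ≤
        Real.log (sepNum T (Icc a b) (k * n) ε) + n * Real.log 2 := by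
      rw [← Real.log_pow, ← Real.log_mul (by positivity) (by positivity)]
      exact Real.log_le_log (by exact_mod_cast hl) (by exact_mod_cast hle n)
    have h2 := mul_le_mul_of_nonneg_left hlog (inv_nonneg.2 (Nat.cast_nonneg (α := ℝ) (k * n)))
    have h3 : ((k * n : ℕ) : ℝ)⁻¹ * (n * Real.log 2) = Real.log 2 / k := by
      push_cast
      field_simp
    rw [mul_add, h3] at h2
    linarith
  · exact (h.tendsto_upper hε hL).isBoundedUnder_le.mono_le
      (Eventually.of_forall (h.inv_mul_log_sepNum_le hε))

/-- The Misiurewicz-Szlenk formula. -/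
theorem tendsto_log_lapNum (h : IsPiecewiseMonoMap a b T) :
    Tendsto (fun n : ℕ => (n : ℝ)⁻¹ * Real.log (lapNum a b T^[n])) atTop
      (nhds (htop T (Icc a b))) := by
  obtain ⟨L, hL⟩ := h.exists_tendsto_log_lapNum
  have hle : htop T (Icc a b) ≤ L := by
    have : Nonempty {ε : ℝ // 0 < ε} := ⟨⟨1, one_pos⟩⟩
    exact ciSup_le fun ε => h.limsup_sepNum_le ε.2 hL
  have hge : L ≤ htop T (Icc a b) := by
    have hlim : Tendsto (fun k : ℕ => L - Real.log 2 / k) atTop (nhds (L - 0)) :=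
      tendsto_const_nhds.sub (tendsto_const_div_atTop_nhds_zero_nat _)
    rw [sub_zero] at hlim
    exact le_of_tendsto hlim ((eventually_gt_atTop 0).mono
      fun k hk => h.sub_log_two_div_le_htop hL hk)
  rwa [hle.antisymm hge]

end IsPiecewiseMonoMap

/-- To the right of each point of `[u,v)`, the function `f` is affine with slope `s` or `-s`. -/
def HasRightSlopes (s u v : ℝ) (f : ℝ → ℝ) : Prop :=
  ∀ y ∈ Ico u v, ∃ σ, (σ = s ∨ σ = -s) ∧ ∃ d > y, ∀ z ∈ Icc y d, f z = f y + σ * (z - y)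

lemma HasRightSlopes.mono {s u v u' v' : ℝ} {f : ℝ → ℝ} (h : HasRightSlopes s u v f)
    (hu : u ≤ u') (hv : v' ≤ v) : HasRightSlopes s u' v' f :=
  fun y hy => h y ⟨hu.trans hy.1, hy.2.trans_le hv⟩

lemma HasRightSlopes.neg {s u v : ℝ} {f : ℝ → ℝ} (h : HasRightSlopes s u v f) :
    HasRightSlopes s u v fun x => -f x := by
  intro y hy
  obtain ⟨σ, hσ, d, hd, hf⟩ := h y hy
  refine ⟨-σ, ?_, d, hd, fun z hz => ?_⟩
  · rcases hσ with rfl | rfl <;> simp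
  · linarith [hf z hz]

lemma hasRightSlopes_of_partition {a b s : ℝ} {T : ℝ → ℝ} {N : ℕ} {x : Fin (N + 1) → ℝ}
    (h0 : x 0 = a) (h1 : x (Fin.last N) = b)
    (h : ∀ j : Fin N, ∃ cst σ : ℝ, (σ = s ∨ σ = -s) ∧
      ∀ y ∈ Icc (x j.castSucc) (x j.succ), T y = σ * y + cst) : HasRightSlopes s a b T := by
  intro y hy
  obtain ⟨j, hj⟩ := exists_mem_Ico_succ x (h0 ▸ hy.1) (h1 ▸ hy.2)
  obtain ⟨c, σ, hσ, hf⟩ := h j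
  refine ⟨σ, hσ, _, hj.2, fun z hz => ?_⟩
  rw [hf z ⟨hj.1.trans hz.1, hz.2⟩, hf y ⟨hj.1, hj.2.le⟩]
  ring

lemma hasDerivWithinAt_of_eq_affine {f : ℝ → ℝ} {y d σ : ℝ} (hd : y < d)
    (hf : ∀ z ∈ Icc y d, f z = f y + σ * (z - y)) : HasDerivWithinAt f σ (Ici y) y := by
  have h1 : HasDerivWithinAt (fun z => f y + σ * (z - y)) σ (Ici y) y := by
    simpa using ((((hasDerivAt_id y).sub_const y).const_mul σ).const_add (f y)).hasDerivWithinAt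
  exact h1.congr_of_eventuallyEq (eventually_of_mem (Icc_mem_nhdsGE hd) hf) (by simp)

lemma HasRightSlopes.abs_sub_le {s u v : ℝ} (hs : 0 < s) {f : ℝ → ℝ} (h : HasRightSlopes s u v f)
    (hf : ContinuousOn f (Icc u v)) (huv : u ≤ v) : |f v - f u| ≤ s * |v - u| := by
  choose! σ hσ d hd hfd using h
  rw [abs_of_nonneg (sub_nonneg.2 huv)]
  refine norm_image_sub_le_of_norm_deriv_right_le_segment hf
    (fun y hy => hasDerivWithinAt_of_eq_affine (hd y hy) (hfd y hy)) (fun y hy => ?_) v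
    ⟨huv, le_rfl⟩
  rw [Real.norm_eq_abs]
  rcases hσ y hy with h | h <;> rw [h] <;> simp [abs_of_pos hs]

lemma HasRightSlopes.sub_eq_of_monotoneOn {s u v : ℝ} (hs : 0 < s) {f : ℝ → ℝ}
    (h : HasRightSlopes s u v f) (hf : ContinuousOn f (Icc u v)) (huv : u ≤ v)
    (hm : MonotoneOn f (Icc u v)) : f v - f u = s * (v - u) := by
  have hconst := constant_of_has_deriv_right_zero (f := fun y => f y - s * y)
    (hf.sub (by fun_prop)) (fun y hy => ?_) v ⟨huv, le_rfl⟩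
  · linarith
  · obtain ⟨σ, hσ, d, hd, hfd⟩ := h y hy
    have hmin : y < min d v := lt_min hd hy.2
    have h1 := hfd (min d v) ⟨hmin.le, min_le_left _ _⟩
    have h2 := hm ⟨hy.1, hy.2.le⟩ ⟨hy.1.trans hmin.le, min_le_right _ _⟩ hmin.le
    rcases hσ with rfl | rfl
    · exact hasDerivWithinAt_of_eq_affine hd fun z hz => by rw [hfd z hz]; ring
    · nlinarith [mul_pos hs (sub_pos.2 hmin)]

lemma HasRightSlopes.abs_sub_eq {a b s : ℝ} (hs : 0 < s) {f : ℝ → ℝ}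
    (h : HasRightSlopes s a b f) (hf : ContinuousOn f (Icc a b)) {p q : ℝ} (hp : p ∈ Icc a b)
    (hq : q ∈ Icc a b) (hm : MonoOrAntiOn f (uIcc p q)) : |f q - f p| = s * |q - p| := by
  wlog hpq : p ≤ q generalizing p q
  · rw [abs_sub_comm, abs_sub_comm q]
    exact this hq hp (by rwa [uIcc_comm]) (le_of_not_ge hpq)
  rw [uIcc_of_le hpq] at hm
  have hsl := h.mono hp.1 hq.2
  have hc := hf.mono (Icc_subset_Icc hp.1 hq.2)
  have hpq' : 0 ≤ s * (q - p) := mul_nonneg hs.le (sub_nonneg.2 hpq)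
  rw [abs_of_nonneg (sub_nonneg.2 hpq)]
  rcases hm with hm | hm
  · rw [hsl.sub_eq_of_monotoneOn hs hc hpq hm, abs_of_nonneg hpq']
  · have := hsl.neg.sub_eq_of_monotoneOn hs hc.neg hpq hm.neg
    rw [show f q - f p = -(s * (q - p)) by linarith, abs_neg, abs_of_nonneg hpq']

lemma le_add_mul_of_succ_le {N : ℕ} {x : Fin (N + 1) → ℝ} {d : ℝ}
    (h : ∀ j : Fin N, x j.succ - x j.castSucc ≤ d) (i : Fin (N + 1)) :
    x i ≤ x 0 + (i : ℕ) * d := by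
  induction i using Fin.induction with
  | zero => simp
  | succ j ih =>
    have := h j
    simp only [Fin.val_castSucc, Fin.val_succ] at ih ⊢
    push_cast
    linarith

namespace IsPiecewiseMonoMap

variable {a b s : ℝ} {T : ℝ → ℝ}

lemma abs_iterate_sub_eq (h : IsPiecewiseMonoMap a b T) (hs : 0 < s)
    (hsl : HasRightSlopes s a b T) {u v : ℝ} (huv : u ≤ v) (hsub : Icc u v ⊆ Icc a b) {n : ℕ}
    (hm : MonoOrAntiOn T^[n] (Icc u v)) {i : ℕ} (hi : i ≤ n) :
    |T^[i] v - T^[i] u| = s ^ i * (v - u) := by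
  induction i with
  | zero => simp [abs_of_nonneg (sub_nonneg.2 huv)]
  | succ i ih =>
    have hu := hsub ⟨le_rfl, huv⟩
    have hv := hsub ⟨huv, le_rfl⟩
    have hc : ContinuousOn T^[i] (Icc u v) := (h.iterate i).continuousOn.mono hsub
    have himg : uIcc (T^[i] u) (T^[i] v) ⊆ T^[i] '' Icc u v := by
      have := intermediate_value_uIcc (f := T^[i]) (a := u) (b := v) (by rwa [uIcc_of_le huv])
      rwa [uIcc_of_le huv] at this
    have hinj : InjOn T (uIcc (T^[i] u) (T^[i] v)) := by
      have hinj' := injOn_iterate_of_mono h.mapsTo h.finite_fiber hsub ordConnected_Icc hm hi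
      rw [Function.iterate_succ'] at hinj'
      exact hinj'.image_of_comp.mono himg
    have hm' : MonoOrAntiOn T (uIcc (T^[i] u) (T^[i] v)) :=
      InjOn.monoOrAntiOn inf_le_sup hinj (h.continuousOn.mono (himg.trans
        (image_subset_iff.2 fun y hy => h.mapsTo.iterate i (hsub hy))))
    rw [Function.iterate_succ_apply', Function.iterate_succ_apply',
      hsl.abs_sub_eq hs h.continuousOn (h.mapsTo.iterate i hu) (h.mapsTo.iterate i hv) hm',
      ih (Nat.le_of_succ_le hi)]
    ring

lemma pow_le_lapNum (h : IsPiecewiseMonoMap a b T) (hs : 0 < s) (hsl : HasRightSlopes s a b T)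
    (n : ℕ) : s ^ n ≤ lapNum a b T^[n] := by
  obtain ⟨x, hx⟩ := (h.iterate n).exists_lapNum
  have hsn : 0 < s ^ n := pow_pos hs n
  have hgap : ∀ j, x (Fin.succ j) - x (Fin.castSucc j) ≤ (b - a) / s ^ n := by
    intro j
    have hlt := (hx.strictMono (Fin.castSucc_lt_succ (i := j))).le
    have hsub := (hx.isMonoPiece j).subset
    rw [le_div_iff₀' hsn, ← h.abs_iterate_sub_eq hs hsl hlt hsub (hx.mono j) le_rfl]
    have h1 := h.mapsTo.iterate n (hsub ⟨le_rfl, hlt⟩)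
    have h2 := h.mapsTo.iterate n (hsub ⟨hlt, le_rfl⟩)
    exact abs_sub_le_iff.2 ⟨by linarith [h1.1, h2.2], by linarith [h1.2, h2.1]⟩
  have hlast := le_add_mul_of_succ_le hgap (Fin.last _)
  rw [hx.left, hx.right, Fin.val_last, mul_div_assoc', ← sub_le_iff_le_add', le_div_iff₀ hsn,
    mul_comm] at hlast
  exact le_of_mul_le_mul_right hlast (sub_pos.2 h.lt)

lemma abs_iterate_sub_le (h : IsPiecewiseMonoMap a b T) (hs : 0 < s)
    (hsl : HasRightSlopes s a b T) {x y : ℝ} (hx : x ∈ Icc a b) (hy : y ∈ Icc a b) (i : ℕ) :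
    |T^[i] x - T^[i] y| ≤ s ^ i * |x - y| := by
  have hlip : ∀ x ∈ Icc a b, ∀ y ∈ Icc a b, |T x - T y| ≤ s * |x - y| := by
    intro x hx y hy
    wlog hyx : y ≤ x generalizing x y
    · rw [abs_sub_comm, abs_sub_comm x]
      exact this y hy x hx (le_of_not_ge hyx)
    exact (hsl.mono hy.1 hx.2).abs_sub_le hs
      (h.continuousOn.mono (Icc_subset_Icc hy.1 hx.2)) hyx
  induction i with
  | zero => simp
  | succ i ih =>
    rw [Function.iterate_succ_apply', Function.iterate_succ_apply', pow_succ', mul_assoc]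
    exact (hlip _ (h.mapsTo.iterate i hx) _ (h.mapsTo.iterate i hy)).trans
      (mul_le_mul_of_nonneg_left ih hs.le)

lemma sepNum_le_pow (h : IsPiecewiseMonoMap a b T) (hs : 0 < s) (hsl : HasRightSlopes s a b T)
    {ε : ℝ} (hε : 0 < ε) (n : ℕ) :
    (sepNum T (Icc a b) n ε : ℝ) ≤ ((b - a) / ε + 1) * max 1 s ^ n := by
  have hm : 1 ≤ max 1 s ^ n := one_le_pow₀ (le_max_left _ _)
  have hmpos : 0 < max 1 s ^ n := one_pos.trans_le hm
  have hW : 0 ≤ (b - a) / ε := div_nonneg (sub_nonneg.2 h.lt.le) hε.le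
  have hcard : sepNum T (Icc a b) n ε ≤ ⌊(b - a) / (ε / max 1 s ^ n)⌋₊ + 1 := by
    refine sepNum_le fun S hS hsep => card_le_of_le_abs_sub (F := id) (c := a)
      (div_pos hε hmpos) (fun x hx => by simpa using hS hx) fun x hx y hy hxy => ?_
    obtain ⟨i, hi, hle⟩ := hsep x hx y hy hxy
    rw [div_le_iff₀' hmpos]
    refine (hle.trans (h.abs_iterate_sub_le hs hsl (hS hx) (hS hy) i)).trans
      (mul_le_mul_of_nonneg_right ?_ (abs_nonneg _))
    exact (pow_le_pow_left₀ hs.le (le_max_right _ _) i).trans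
      (pow_le_pow_right₀ (le_max_left _ _) hi.le)
  have hdiv : (b - a) / (ε / max 1 s ^ n) = (b - a) / ε * max 1 s ^ n := by
    rw [div_div_eq_mul_div, div_mul_eq_mul_div]
  rw [hdiv] at hcard
  have hcard' : (sepNum T (Icc a b) n ε : ℝ) ≤ (⌊(b - a) / ε * max 1 s ^ n⌋₊ : ℝ) + 1 := by
    exact_mod_cast hcard
  linarith [Nat.floor_le (mul_nonneg hW hmpos.le)]

theorem htop_eq_of_hasRightSlopes (h : IsPiecewiseMonoMap a b T) (hs : 0 < s)
    (hsl : HasRightSlopes s a b T) : htop T (Icc a b) = max 0 (Real.log s) := by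
  refine le_antisymm ?_ (max_le ?_ ?_)
  · have : Nonempty {ε : ℝ // 0 < ε} := ⟨⟨1, one_pos⟩⟩
    refine ciSup_le fun ⟨ε, hε⟩ => ?_
    have hD : 0 < (b - a) / ε + 1 := by
      have := div_pos (sub_pos.2 h.lt) hε
      positivity
    have hm : 0 < max 1 s := lt_max_of_lt_left one_pos
    have hlogm : Real.log (max 1 s) = max 0 (Real.log s) := by
      rw [← Real.log_one]
      exact Real.strictMonoOn_log.monotoneOn.map_max (mem_Ioi.2 one_pos) (mem_Ioi.2 hs)
    have hw : Tendsto (fun n : ℕ => (n : ℝ)⁻¹ * Real.log ((b - a) / ε + 1) +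
        max 0 (Real.log s)) atTop (nhds (max 0 (Real.log s))) := by
      simpa using ((tendsto_inv_atTop_nhds_zero_nat (𝕜 := ℝ)).mul_const
        (Real.log ((b - a) / ε + 1))).add_const (max 0 (Real.log s))
    refine limsup_inv_mul_log_le ((eventually_gt_atTop 0).mono fun n hn => ?_) hw
    have hn' : (n : ℝ) ≠ 0 := Nat.cast_ne_zero.2 hn.ne'
    have hlog := Real.log_le_log (by exact_mod_cast h.sepNum_pos hε)
      (h.sepNum_le_pow hs hsl hε n)
    rw [Real.log_mul hD.ne' (pow_pos hm n).ne', Real.log_pow, hlogm] at hlog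
    refine (mul_le_mul_of_nonneg_left hlog (inv_nonneg.2 n.cast_nonneg)).trans_eq ?_
    rw [mul_add, inv_mul_cancel_left₀ hn']
  · exact ge_of_tendsto' h.tendsto_log_lapNum fun n => inv_mul_log_natCast_nonneg n _
  · refine ge_of_tendsto h.tendsto_log_lapNum ((eventually_gt_atTop 0).mono fun n hn => ?_)
    rw [inv_mul_eq_div, le_div_iff₀' (Nat.cast_pos.2 hn), ← Real.log_pow]
    exact Real.log_le_log (pow_pos hs n) (h.pow_le_lapNum hs hsl n)

end IsPiecewiseMonoMap

theorem stmt19 (a b : ℝ) (hab : a < b) (T : ℝ → ℝ)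
    (hmap : MapsTo T (Icc a b) (Icc a b))
    -- T is piecewise monotone
    (hpm : ∃ (N : ℕ) (x : Fin (N + 1) → ℝ), StrictMono x ∧ x 0 = a ∧ x (Fin.last N) = b ∧
      ∀ j : Fin N, ContinuousOn T (Icc (x j.castSucc) (x j.succ)) ∧
        (StrictMonoOn T (Icc (x j.castSucc) (x j.succ)) ∨
          StrictAntiOn T (Icc (x j.castSucc) (x j.succ)))) :
    Tendsto (fun n : ℕ => (n : ℝ)⁻¹ * Real.log (lapNum a b (T^[n]))) atTop
        (nhds (htop T (Icc a b))) ∧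
      ∀ s : ℝ, 0 < s →
        (∃ (N : ℕ) (x : Fin (N + 1) → ℝ), StrictMono x ∧ x 0 = a ∧ x (Fin.last N) = b ∧
          ∀ j : Fin N, ∃ cst σ : ℝ, (σ = s ∨ σ = -s) ∧
            ∀ y ∈ Icc (x j.castSucc) (x j.succ), T y = σ * y + cst) →
        htop T (Icc a b) = max 0 (Real.log s) := by
  obtain ⟨N, x, hx, h0, h1, hpieces⟩ := hpm
  have h := IsPiecewiseMonoMap.of_strict hab hmap hx h0 h1 hpieces
  refine ⟨h.tendsto_log_lapNum, fun s hs ⟨M, y, _, hy0, hy1, hy⟩ => ?_⟩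
  exact h.htop_eq_of_hasRightSlopes hs (hasRightSlopes_of_partition hy0 hy1 hy)
end
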